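/- Let Γ be a countable discrete group. If Γ is nonexact (i.e., no continuous action of Γ on a nonempty compact metrizable space is topologically amenable), then there exists a sequence of finite IREs on Γ converging weakly to an IRE which is not an amenable IRE. -/

import Mathlib

open MeasureTheory Filter Topology

/-- A function `r : Γ × Γ → Bool` codes an equivalence relation on `Γ`. -/
def IsEqRel {Γ : Type*} (r : Γ × Γ → Bool) : Prop :=
  (∀ x, r (x, x) = true) ∧ (∀ x y, r (x, y) = true → r (y, x) = true) ∧
    (∀ x y z, r (x, y) = true → r (y, z) = true → r (x, z) = true)

/-- The space `E` of equivalence relations on `Γ`, as a subspace of `{0,1}^{Γ×Γ}`. -/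
abbrev EqRelSpace (Γ : Type*) : Type _ := ↥{r : Γ × Γ → Bool | IsEqRel r}

variable {Γ : Type*} [Group Γ]

/-- The left shift action of `Γ` on the space of equivalence relations:
`(γ·r)(x,y) = r(γ⁻¹x, γ⁻¹y)`. -/
def shiftE (γ : Γ) (r : EqRelSpace Γ) : EqRelSpace Γ :=
  ⟨fun p => r.1 (γ⁻¹ * p.1, γ⁻¹ * p.2),
    ⟨fun _ => r.2.1 _, fun _ _ h => r.2.2.1 _ _ h, fun _ _ _ h h' => r.2.2.2 _ _ _ h h'⟩⟩

/-- The `r`-class of `g ∈ Γ`. -/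
def classOf (r : EqRelSpace Γ) (g : Γ) : Set Γ := {h | r.1 (g, h) = true}

/-- An invariant random equivalence relation: a Borel probability measure on `E`
invariant under the left shift action. -/
def IsIRE (ρ : ProbabilityMeasure (EqRelSpace Γ)) : Prop :=
  ∀ γ : Γ, ρ.toMeasure.map (shiftE γ) = ρ.toMeasure

/-- A finite IRE: almost every equivalence relation has all classes finite. -/
def IsFIRE (ρ : ProbabilityMeasure (EqRelSpace Γ)) : Prop :=
  IsIRE ρ ∧ ∀ᵐ r ∂ρ.toMeasure, ∀ g : Γ, (classOf r g).Finite

/-- An amenable IRE: there are Borel maps `λ_n : E → Prob(Γ)` (coded coordinatewise as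
`lam : ℕ → E → Γ → ℝ`) such that for a.e. `r` and every `g` in the class of the identity,
`‖g⁻¹·λ_n^r − λ_n^{g⁻¹·r}‖₁ → 0`; here `(g⁻¹·λ_n^r)(h) = λ_n^r(gh)`. -/
def IsAIRE (ρ : ProbabilityMeasure (EqRelSpace Γ)) : Prop :=
  IsIRE ρ ∧ ∃ lam : ℕ → EqRelSpace Γ → Γ → ℝ,
    (∀ n g, Measurable fun r => lam n r g) ∧
    (∀ n r g, 0 ≤ lam n r g) ∧
    (∀ n r, ∑' g, lam n r g = 1) ∧
    ∀ᵐ r ∂ρ.toMeasure, ∀ g ∈ classOf r 1,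
      Tendsto (fun n => ∑' h : Γ, |lam n r (g * h) - lam n (shiftE g⁻¹ r) h|) atTop (𝓝 0)

/-- Topological amenability of an action `a : Γ → X → X` on a topological space:
there are continuous maps `η_n : X → Prob(Γ)` (coded coordinatewise) with
`sup_x ‖γ·η_n^x − η_n^{γ·x}‖₁ → 0` for every `γ`; here `(γ·η)(g) = η(γ⁻¹g)`. -/
def TopAmenableAction (Γ : Type*) [Group Γ] {X : Type*} [TopologicalSpace X]
    (a : Γ → X → X) : Prop :=
  ∃ η : ℕ → X → Γ → ℝ,
    (∀ n x g, 0 ≤ η n x g) ∧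
    (∀ n x, ∑' g, η n x g = 1) ∧
    (∀ n g, Continuous fun x => η n x g) ∧
    ∀ γ : Γ, ∀ ε > (0 : ℝ), ∃ N, ∀ n ≥ N, ∀ x : X,
      ∑' g : Γ, |η n x (γ⁻¹ * g) - η n (a γ x) g| < ε

/-- A countable group is exact iff it admits a topologically amenable continuous action
on a nonempty compact metrizable space. -/
def IsExactGroup (Γ : Type*) [Group Γ] : Prop :=
  ∃ (X : Type) (_ : TopologicalSpace X) (a : Γ → X → X),
    Nonempty X ∧ CompactSpace X ∧ TopologicalSpace.MetrizableSpace X ∧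
    (∀ x, a 1 x = x) ∧ (∀ γ δ x, a (γ * δ) x = a γ (a δ x)) ∧
    (∀ γ, Continuous (a γ)) ∧ TopAmenableAction Γ a

section Exactness

open scoped Classical

/-- The points of `F` outside `E` that are joined to `E` by an element of `S`. -/
noncomputable def outerBoundary (S F E : Finset Γ) : Finset Γ :=
  F.filter fun y => y ∉ E ∧ ∃ s ∈ S, y * s ∈ E

/-- Removing `R` from `V` splits `V` into `S`-separated pieces, each inside a translate of `B`. -/
def IsSeparator (S B V R : Finset Γ) : Prop :=
  R ⊆ V ∧ ∃ c : Γ → Γ, (∀ x ∈ V, x ∉ R → (c x)⁻¹ * x ∈ B) ∧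
    ∀ x ∈ V, x ∉ R → ∀ s ∈ S, x * s ∈ V → x * s ∉ R → c x = c (x * s)

theorem exists_isSeparator_card_le {S B : Finset Γ} (hS : ∀ s ∈ S, s⁻¹ ∈ S) {ε : ℝ} (hε : 0 ≤ ε)
    (h : ∀ F : Finset Γ, F.Nonempty → ∃ E ⊆ F, E.Nonempty ∧ (∃ g, ∀ x ∈ E, g⁻¹ * x ∈ B) ∧
      ((outerBoundary S F E).card : ℝ) ≤ ε * E.card) (F : Finset Γ) :
    ∃ R, IsSeparator S B F R ∧ (R.card : ℝ) ≤ ε * F.card := by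
  induction F using Finset.strongInduction with
  | H F ih =>
  rcases F.eq_empty_or_nonempty with rfl | hF
  · exact ⟨∅, ⟨subset_rfl, fun _ => 1, by simp, by simp⟩, by simp⟩
  obtain ⟨E, hEF, hE, ⟨g, hg⟩, hb⟩ := h F hF
  set D := outerBoundary S F E with hD
  have hmemD : ∀ y, y ∈ D ↔ y ∈ F ∧ y ∉ E ∧ ∃ s ∈ S, y * s ∈ E := fun y => by
    simp [hD, outerBoundary]
  have hDF : D ⊆ F := Finset.filter_subset _ _
  obtain ⟨e, he⟩ := hE
  have hlt : F \ (E ∪ D) ⊂ F := by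
    refine Finset.ssubset_iff_subset_ne.2 ⟨Finset.sdiff_subset, fun heq => ?_⟩
    have : e ∈ F \ (E ∪ D) := by rw [heq]; exact hEF he
    simp [he] at this
  obtain ⟨R, ⟨hRF, c, hc1, hc2⟩, hR⟩ := ih _ hlt
  have hmem' : ∀ x ∈ F, x ∉ D ∪ R → x ∉ E → x ∈ F \ (E ∪ D) ∧ x ∉ R := by
    intro x hx h1 h2
    simp only [Finset.mem_union, not_or] at h1
    simp [hx, h1, h2]
  refine ⟨D ∪ R, ⟨Finset.union_subset hDF (hRF.trans Finset.sdiff_subset),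
    fun x => if x ∈ E then g else c x, ?_, ?_⟩, ?_⟩
  · intro x hx hxR
    by_cases hxE : x ∈ E
    · simpa [hxE] using hg x hxE
    · have := hmem' x hx hxR hxE
      simpa [hxE] using hc1 x this.1 this.2
  · intro x hx hxR s hs hxs hxsR
    by_cases hxE : x ∈ E <;> by_cases hxsE : x * s ∈ E
    · simp [hxE, hxsE]
    · exfalso
      apply hxsR
      refine Finset.mem_union_left _ ((hmemD _).2 ⟨hxs, hxsE, s⁻¹, hS s hs, ?_⟩)
      simpa using hxE
    · exfalso
      exact hxR (Finset.mem_union_left _ ((hmemD _).2 ⟨hx, hxE, s, hs, hxsE⟩))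
    · have h1 := hmem' x hx hxR hxE
      have h2 := hmem' _ hxs hxsR hxsE
      simpa [hxE, hxsE] using hc2 x h1.1 h1.2 s hs h2.1 h2.2
  · have h1 : ((D ∪ R).card : ℝ) ≤ D.card + R.card := by
      exact_mod_cast Finset.card_union_le _ _
    have h2 : (E.card : ℝ) + (F \ (E ∪ D)).card ≤ F.card := by
      rw [← Nat.cast_add, ← Finset.card_union_of_disjoint]
      · exact_mod_cast Finset.card_le_card (Finset.union_subset hEF Finset.sdiff_subset)
      · exact Finset.disjoint_left.2 fun x hx => by simp [hx]
    nlinarith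

theorem exists_smoothing {S V : Finset Γ} (m : Γ → ℝ)
    (hm : ∀ x, 0 ≤ m x) : ∃ m' : Γ → ℝ, (∀ x ∈ V, m x ≤ m' x) ∧
      (∑ x ∈ V, m' x ≤ 2 * ∑ x ∈ V, m x) ∧
      ∀ x ∈ V, ∀ s ∈ S, x * s ∈ V → m' (x * s) ≤ ((2 * S.card + 2 : ℕ) : ℝ) * m' x := by
  set q : ℝ := ((2 * S.card + 2 : ℕ) : ℝ) with hq
  have hq0 : 0 < q := by rw [hq]; positivity
  let T : (Γ → ℝ) → Γ → ℝ := fun f x => q⁻¹ * ∑ s ∈ S, if x * s ∈ V then f (x * s) else 0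
  let a : ℕ → Γ → ℝ := fun k => T^[k] m
  have ha0 : a 0 = m := rfl
  have hasucc : ∀ k, a (k + 1) = T (a k) := fun k => Function.iterate_succ_apply' T k m
  have hann : ∀ k x, 0 ≤ a k x := by
    intro k
    induction k with
    | zero => exact hm
    | succ k ih =>
      intro x
      rw [hasucc]
      refine mul_nonneg (inv_nonneg.2 hq0.le) (Finset.sum_nonneg fun s _ => ?_)
      split_ifs
      · exact ih _
      · exact le_rfl
  set M := ∑ x ∈ V, m x with hM
  have hsum : ∀ k, ∑ x ∈ V, a k x ≤ M * (1 / 2) ^ k := by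
    intro k
    induction k with
    | zero => simp [ha0, hM]
    | succ k ih =>
      have h1 : ∑ x ∈ V, a (k + 1) x ≤ q⁻¹ * (S.card * ∑ x ∈ V, a k x) := by
        simp only [hasucc, T]
        rw [← Finset.mul_sum, Finset.sum_comm]
        refine mul_le_mul_of_nonneg_left ?_ (inv_nonneg.2 hq0.le)
        rw [← nsmul_eq_mul]
        refine Finset.sum_le_card_nsmul _ _ _ fun s _ => ?_
        rw [← Finset.sum_filter]
        rw [← Finset.sum_image (f := a k) (g := fun x => x * s) (fun x _ y _ h => mul_right_cancel h)]
        refine Finset.sum_le_sum_of_subset_of_nonneg ?_ fun x _ _ => hann k x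
        intro y hy
        simp only [Finset.mem_image, Finset.mem_filter] at hy
        obtain ⟨x, ⟨_, h⟩, rfl⟩ := hy
        exact h
      have h2 : 0 ≤ ∑ x ∈ V, a k x := Finset.sum_nonneg fun x _ => hann k x
      have h3 : q⁻¹ * S.card ≤ 1 / 2 := by
        rw [inv_mul_le_iff₀ hq0, hq]; push_cast; linarith
      calc _ ≤ (q⁻¹ * S.card) * ∑ x ∈ V, a k x := by rw [mul_assoc]; exact h1
        _ ≤ (1 / 2) * (M * (1 / 2) ^ k) := by
          apply mul_le_mul h3 ih h2 (by norm_num)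
        _ = _ := by ring
  have hsumm : ∀ x ∈ V, Summable fun k => a k x := by
    intro x hx
    refine Summable.of_nonneg_of_le (fun k => hann k x) (fun k => ?_)
      ((summable_geometric_of_lt_one (r := (1 / 2 : ℝ)) (by norm_num) (by norm_num)).mul_left M)
    exact (Finset.single_le_sum (fun y _ => hann k y) hx).trans (hsum k)
  refine ⟨fun x => ∑' k, a k x, ?_, ?_, ?_⟩
  · intro x hx
    exact (hsumm x hx).le_tsum 0 fun k _ => hann k x
  · rw [← Summable.tsum_finsetSum hsumm]
    refine (Summable.tsum_le_tsum hsum (summable_sum hsumm)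
      ((summable_geometric_of_lt_one (r := (1 / 2 : ℝ)) (by norm_num) (by norm_num)).mul_left M)).trans
      (le_of_eq ?_)
    rw [tsum_mul_left, tsum_geometric_of_lt_one (by norm_num) (by norm_num)]
    ring
  · intro x hx s hs hxs
    have h1 : ∀ k, q⁻¹ * a k (x * s) ≤ a (k + 1) x := by
      intro k
      rw [hasucc]
      refine mul_le_mul_of_nonneg_left ?_ (inv_nonneg.2 hq0.le)
      have := Finset.single_le_sum (f := fun s => if x * s ∈ V then a k (x * s) else 0)
        (fun s _ => by split_ifs; exacts [hann _ _, le_rfl]) hs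
      simpa [hxs] using this
    have h2 : q⁻¹ * ∑' k, a k (x * s) ≤ ∑' k, a k x := by
      rw [(hsumm x hx).tsum_eq_zero_add, ← tsum_mul_left]
      have := Summable.tsum_le_tsum h1 ((hsumm _ hxs).mul_left _)
        ((summable_nat_add_iff 1).2 (hsumm x hx))
      linarith [hann 0 x]
    rwa [inv_mul_le_iff₀ hq0] at h2
theorem exists_isSeparator_weight_le_of_pos {S B : Finset Γ} (hS : ∀ s ∈ S, s⁻¹ ∈ S) {ε : ℝ}
    {L : ℕ} (hL : 0 < L) (hε : 0 ≤ ε)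
    (h : ∀ F : Finset Γ, ∃ R, IsSeparator S B F R ∧
      (R.card : ℝ) * ((2 * S.card + 2 : ℕ) : ℝ) ^ L ≤ ε * F.card)
    (V : Finset Γ) (m : Γ → ℝ) (hm : ∀ x, 0 ≤ m x) (hpos : ∀ x ∈ V, 0 < m x) :
    ∃ R, IsSeparator S B V R ∧ ∑ x ∈ R, m x ≤ 2 * (1 / L + ε) * ∑ x ∈ V, m x := by
  obtain ⟨w, hw1, hw2, hw3⟩ := exists_smoothing (S := S) (V := V) m hm
  set q : ℕ := 2 * S.card + 2 with hq
  have hq1 : 1 < q := by omega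
  have hq0 : (0 : ℝ) < q := by positivity
  have hwpos : ∀ x ∈ V, 0 < w x := fun x hx => (hpos x hx).trans_le (hw1 x hx)
  set l : Γ → ℤ := fun x => Int.log q (w x) with hl
  have hl1 : ∀ x ∈ V, (q : ℝ) ^ l x ≤ w x := fun x hx => Int.zpow_log_le_self hq1 (hwpos x hx)
  have hl2 : ∀ x, w x < (q : ℝ) ^ (l x + 1) := fun x => Int.lt_zpow_succ_log_self hq1 _
  have hladj : ∀ x ∈ V, ∀ s ∈ S, x * s ∈ V → l (x * s) ≤ l x + 1 := by
    intro x hx s hs hxs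
    have h1 : (q : ℝ) ^ l (x * s) < (q : ℝ) ^ (l x + 2) :=
      calc _ ≤ w (x * s) := hl1 _ hxs
        _ ≤ q * w x := hw3 x hx s hs hxs
        _ < q * (q : ℝ) ^ (l x + 1) := mul_lt_mul_of_pos_left (hl2 x) hq0
        _ = _ := by
          rw [show l x + 2 = (l x + 1) + 1 by ring, zpow_add_one₀ hq0.ne' (l x + 1), mul_comm]
    have := (zpow_lt_zpow_iff_right₀ (by exact_mod_cast hq1)).1 h1
    omega
  have hLZ : (0 : ℤ) < L := by exact_mod_cast hL
  obtain ⟨a, ha⟩ : ∃ a : ℤ, ∑ x ∈ V with (L : ℤ) ∣ l x - a, w x ≤ (1 / L) * ∑ x ∈ V, w x := by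
    obtain ⟨a, _, ha⟩ := Finset.exists_le_of_sum_le (s := Finset.range L)
      (f := fun a : ℕ => ∑ x ∈ V with (L : ℤ) ∣ l x - (a : ℤ), w x)
      (g := fun _ : ℕ => (1 / L) * ∑ x ∈ V, w x) (by simpa using hL.ne') (by
        rw [Finset.sum_const, Finset.card_range, nsmul_eq_mul, ← mul_assoc,
          mul_one_div_cancel (by positivity), one_mul]
        have hunion : V = (Finset.range L).biUnion fun a : ℕ => V.filter fun x => (L : ℤ) ∣ l x - (a : ℤ) := by
          ext x
          simp only [Finset.mem_biUnion, Finset.mem_range, Finset.mem_filter]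
          refine ⟨fun hx => ⟨(l x % L).toNat, ?_, hx, ?_⟩, fun ⟨_, _, hx, _⟩ => hx⟩
          · have := Int.emod_lt_of_pos (l x) hLZ
            have := Int.emod_nonneg (l x) hLZ.ne'
            omega
          · rw [Int.toNat_of_nonneg (Int.emod_nonneg (l x) hLZ.ne')]
            exact Int.dvd_self_sub_emod
        conv_rhs => rw [hunion]
        rw [Finset.sum_biUnion]
        intro i hi j hj hij
        refine Finset.disjoint_left.2 fun x hx hx' => hij ?_
        simp only [Finset.mem_filter] at hx hx'
        simp only [Finset.coe_range, Set.mem_Iio] at hi hj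
        have h3 : (L : ℤ) ∣ (i : ℤ) - j := by
          have := dvd_sub hx'.2 hx.2
          simpa using this
        have h4 := Int.eq_zero_of_abs_lt_dvd h3 (by rw [abs_lt]; constructor <;> omega)
        omega)
    exact ⟨a, ha⟩
  set j : Γ → ℤ := fun x => (l x - a) / L with hj
  set U : Finset Γ := V.filter fun x => ¬ (L : ℤ) ∣ l x - a with hU
  choose R hR hRcard using fun k : ℤ => h (U.filter fun x => j x = k)
  choose hRsub c hc1 hc2 using hR
  have hRU : ∀ k, ∀ x ∈ R k, x ∈ U ∧ j x = k := fun k x hx => by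
    simpa using hRsub k hx
  have hjl : ∀ x, a + j x * L ≤ l x ∧ l x < a + j x * L + L := by
    intro x
    have h1 := Int.emod_add_mul_ediv (l x - a) L
    have h2 := Int.emod_lt_of_pos (l x - a) hLZ
    have h3 := Int.emod_nonneg (l x - a) hLZ.ne'
    have h4 : (L : ℤ) * j x = j x * L := mul_comm _ _
    simp only [hj] at h4 ⊢
    constructor <;> linarith
  have hjle : ∀ x ∈ U, ∀ y ∈ U, l y ≤ l x + 1 → j y ≤ j x := by
    intro x hx y hy hxy
    by_contra! hlt
    have h1 := hjl x
    have h2 := hjl y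
    have h3 : (j x + 1) * L ≤ j y * L := mul_le_mul_of_nonneg_right (by omega) hLZ.le
    have h4 : (j x + 1) * L = j x * L + L := by ring
    have h5 : l y - a = L * (j x + 1) := by rw [mul_comm]; linarith
    exact (Finset.mem_filter.1 hy).2 ⟨_, h5⟩
  set R0 : Finset Γ := V.filter fun x => (L : ℤ) ∣ l x - a with hR0
  set R1 : Finset Γ := U.filter fun x => x ∈ R (j x) with hR1
  have hUmem : ∀ x ∈ V, x ∉ R0 ∪ R1 → x ∈ U ∧ x ∉ R (j x) := by
    intro x hx hxR
    simp only [hR0, hR1, hU, Finset.mem_union, Finset.mem_filter, not_or] at hxR ⊢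
    tauto
  have hR1V : R1 ⊆ V := (Finset.filter_subset _ _).trans (Finset.filter_subset _ _)
  have hRV : R0 ∪ R1 ⊆ V := Finset.union_subset (Finset.filter_subset _ _) hR1V
  refine ⟨R0 ∪ R1, ⟨hRV, fun x => c (j x) x, ?_, ?_⟩, ?_⟩
  · intro x hx hxR
    obtain ⟨h1, h2⟩ := hUmem x hx hxR
    exact hc1 (j x) x (by simp [h1]) h2
  · intro x hx hxR s hs hxs hxsR
    obtain ⟨h1, h2⟩ := hUmem x hx hxR
    obtain ⟨h3, h4⟩ := hUmem _ hxs hxsR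
    have hjj : j (x * s) = j x := by
      refine le_antisymm (hjle x h1 _ h3 (hladj x hx s hs hxs)) (hjle _ h3 _ h1 ?_)
      simpa using hladj (x * s) hxs s⁻¹ (hS s hs) (by simpa using hx)
    have := hc2 (j x) x (by simp [h1]) h2 s hs (by simp [h3, hjj]) (by rwa [hjj] at h4)
    simpa only [hjj] using this
  · have hR1sum : ∑ x ∈ R1, w x ≤ ε * ∑ x ∈ V, w x := by
      have hblock : ∀ k, ∑ x ∈ R k, w x ≤ ε * ∑ x ∈ U with j x = k, w x := by
        intro k
        have hup : ∑ x ∈ R k, w x ≤ (R k).card * ((q : ℝ) ^ L * (q : ℝ) ^ (a + k * L)) := by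
          rw [← nsmul_eq_mul]
          refine Finset.sum_le_card_nsmul _ _ _ fun x hx => ?_
          refine (hl2 x).le.trans ?_
          rw [← zpow_natCast, ← zpow_add₀ hq0.ne']
          refine zpow_le_zpow_right₀ (by exact_mod_cast hq1.le) ?_
          have := (hjl x).2
          rw [(hRU k x hx).2] at this
          linarith
        have hlow : ((U.filter fun x => j x = k).card : ℝ) * (q : ℝ) ^ (a + k * L) ≤
            ∑ x ∈ U with j x = k, w x := by
          rw [← nsmul_eq_mul]
          refine Finset.card_nsmul_le_sum _ _ _ fun x hx => ?_
          obtain ⟨hxU, hxj⟩ := Finset.mem_filter.1 hx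
          refine le_trans ?_ (hl1 x (Finset.mem_filter.1 hxU).1)
          refine zpow_le_zpow_right₀ (by exact_mod_cast hq1.le) ?_
          have := (hjl x).1
          rwa [hxj] at this
        calc _ ≤ ((R k).card * (q : ℝ) ^ L) * (q : ℝ) ^ (a + k * L) := by rw [mul_assoc]; exact hup
          _ ≤ (ε * (U.filter fun x => j x = k).card) * (q : ℝ) ^ (a + k * L) :=
            mul_le_mul_of_nonneg_right (hRcard k) (by positivity)
          _ ≤ _ := by
            rw [mul_assoc]; exact mul_le_mul_of_nonneg_left hlow hε
      have h1 : ∑ x ∈ R1, w x ≤ ∑ k ∈ U.image j, ∑ x ∈ R k, w x := by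
        rw [← Finset.sum_fiberwise_of_maps_to (s := R1) (t := U.image j) (g := j)
          fun x hx => Finset.mem_image_of_mem _ (Finset.mem_filter.1 hx).1]
        refine Finset.sum_le_sum fun k _ => ?_
        refine Finset.sum_le_sum_of_subset_of_nonneg ?_ fun x hx _ =>
          (hwpos x (Finset.mem_filter.1 (hRU k x hx).1).1).le
        intro x hx
        obtain ⟨hx1, rfl⟩ := Finset.mem_filter.1 hx
        exact (Finset.mem_filter.1 hx1).2
      refine h1.trans ((Finset.sum_le_sum fun k _ => hblock k).trans ?_)
      rw [← Finset.mul_sum, Finset.sum_fiberwise_of_maps_to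
        fun x hx => Finset.mem_image_of_mem _ hx]
      refine mul_le_mul_of_nonneg_left ?_ hε
      exact Finset.sum_le_sum_of_subset_of_nonneg (Finset.filter_subset _ _)
        fun x hx _ => (hwpos x hx).le
    calc ∑ x ∈ R0 ∪ R1, m x ≤ ∑ x ∈ R0 ∪ R1, w x := Finset.sum_le_sum fun x hx => hw1 x (hRV hx)
      _ ≤ ∑ x ∈ R0, w x + ∑ x ∈ R1, w x := by
        rw [← Finset.sum_union_inter]
        exact le_add_of_nonneg_right (Finset.sum_nonneg fun x hx =>
          (hwpos x (hR1V (Finset.mem_inter.1 hx).2)).le)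
      _ ≤ (1 / L + ε) * ∑ x ∈ V, w x := by rw [add_mul]; exact add_le_add ha hR1sum
      _ ≤ (1 / L + ε) * (2 * ∑ x ∈ V, m x) := mul_le_mul_of_nonneg_left hw2 (by positivity)
      _ = _ := by ring

theorem exists_isSeparator_weight_le {S : Finset Γ} (hS : ∀ s ∈ S, s⁻¹ ∈ S)
    (h : ∀ ε > (0 : ℝ), ∃ B : Finset Γ, ∀ F : Finset Γ, F.Nonempty → ∃ E ⊆ F, E.Nonempty ∧
      (∃ g, ∀ x ∈ E, g⁻¹ * x ∈ B) ∧ ((outerBoundary S F E).card : ℝ) ≤ ε * E.card)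
    {ε : ℝ} (hε : 0 < ε) :
    ∃ B : Finset Γ, ∀ (V : Finset Γ) (m : Γ → ℝ), (∀ x, 0 ≤ m x) →
      ∃ R, IsSeparator S B V R ∧ ∑ x ∈ R, m x ≤ ε * ∑ x ∈ V, m x := by
  obtain ⟨L, hL⟩ := exists_nat_gt (4 / ε)
  have hL0 : (0 : ℝ) < L := (by positivity : 0 < 4 / ε).trans hL
  have hqpos : (0 : ℝ) < ((2 * S.card + 2 : ℕ) : ℝ) ^ L := by positivity
  obtain ⟨B, hB⟩ := h (ε / 4 / ((2 * S.card + 2 : ℕ) : ℝ) ^ L) (by positivity)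
  refine ⟨B, fun V m hm => ?_⟩
  have hsep : ∀ F : Finset Γ, ∃ R, IsSeparator S B F R ∧
      (R.card : ℝ) * ((2 * S.card + 2 : ℕ) : ℝ) ^ L ≤ ε / 4 * F.card := by
    intro F
    obtain ⟨R, h1, h2⟩ := exists_isSeparator_card_le hS (by positivity) hB F
    refine ⟨R, h1, ?_⟩
    rw [div_mul_eq_mul_div, le_div_iff₀ hqpos] at h2
    exact h2
  obtain ⟨R, ⟨hRV, c, hc1, hc2⟩, hR⟩ := exists_isSeparator_weight_le_of_pos hS
    (by exact_mod_cast hL0) (by positivity) hsep (V.filter fun x => 0 < m x) m hm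
    fun x hx => (Finset.mem_filter.1 hx).2
  have hsub : V.filter (fun x => ¬ 0 < m x) ∪ R ⊆ V :=
    Finset.union_subset (Finset.filter_subset _ _) (hRV.trans (Finset.filter_subset _ _))
  have hmem : ∀ x ∈ V, x ∉ V.filter (fun x => ¬ 0 < m x) ∪ R →
      x ∈ V.filter (fun x => 0 < m x) ∧ x ∉ R := by
    intro x hx hxR
    simp only [Finset.mem_union, Finset.mem_filter, not_or] at hxR ⊢
    tauto
  refine ⟨_, ⟨hsub, c, fun x hx hxR => ?_, fun x hx hxR s hs hxs hxsR => ?_⟩, ?_⟩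
  · exact hc1 x (hmem x hx hxR).1 (hmem x hx hxR).2
  · exact hc2 x (hmem x hx hxR).1 (hmem x hx hxR).2 s hs (hmem _ hxs hxsR).1 (hmem _ hxs hxsR).2
  · have h1 : ∑ x ∈ V.filter (fun x => ¬ 0 < m x) ∪ R, m x ≤ ∑ x ∈ R, m x := by
      rw [← Finset.union_sdiff_self_eq_union.trans (Finset.union_comm _ _), Finset.sum_union
        Finset.disjoint_sdiff]
      refine add_le_iff_nonpos_right _ |>.2 (Finset.sum_nonpos fun x hx => ?_)
      exact not_lt.1 (Finset.mem_filter.1 (Finset.mem_sdiff.1 hx).1).2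
    have h2 : 2 * (1 / (L : ℝ) + ε / 4) ≤ ε := by
      have : 1 / (L : ℝ) ≤ ε / 4 := by
        rw [div_le_iff₀ hL0]
        rw [div_lt_iff₀ hε] at hL
        linarith
      linarith
    have h3 : ∑ x ∈ V with 0 < m x, m x ≤ ∑ x ∈ V, m x :=
      Finset.sum_le_sum_of_subset_of_nonneg (Finset.filter_subset _ _) fun x _ _ => hm x
    exact h1.trans (hR.trans (mul_le_mul h2 h3 (Finset.sum_nonneg fun x _ => hm x) hε.le))
/-- Families of probability vectors on `Γ`, indexed by `Γ` and all supported in `B`. -/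
def localProb (B : Finset Γ) : Set (Γ → Γ → ℝ) :=
  {ζ | ∀ x, (∀ h, 0 ≤ ζ x h) ∧ (∀ h ∉ B, ζ x h = 0) ∧ ∑ h ∈ B, ζ x h = 1}

/-- The `ℓ¹`-distance between the translates `x·ζ x` and `xs·ζ (xs)` of a family `ζ` supported
in `B`. -/
noncomputable def variation (B : Finset Γ) (ζ : Γ → Γ → ℝ) (x s : Γ) : ℝ :=
  ∑ h ∈ B ∪ B.image (s * ·), |ζ x h - ζ (x * s) (s⁻¹ * h)|

theorem localProb_eq_zero {B : Finset Γ} {ζ : Γ → Γ → ℝ} (hζ : ζ ∈ localProb B) (x s : Γ) {h : Γ}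
    (hh : h ∉ B ∪ B.image (s * ·)) : ζ x h = 0 ∧ ζ (x * s) (s⁻¹ * h) = 0 := by
  simp only [Finset.mem_union, Finset.mem_image, not_or, not_exists, not_and] at hh
  exact ⟨(hζ x).2.1 h hh.1, (hζ _).2.1 _ fun hm => hh.2 _ hm (by simp)⟩

theorem tsum_eq_variation {B : Finset Γ} {ζ : Γ → Γ → ℝ} (hζ : ζ ∈ localProb B) (x s : Γ) :
    ∑' h, |ζ x h - ζ (x * s) (s⁻¹ * h)| = variation B ζ x s := by
  refine tsum_eq_sum fun h hh => ?_
  obtain ⟨h1, h2⟩ := localProb_eq_zero hζ x s hh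
  simp [h1, h2]

theorem variation_le_two {B : Finset Γ} {ζ : Γ → Γ → ℝ} (hζ : ζ ∈ localProb B) (x s : Γ) :
    variation B ζ x s ≤ 2 := by
  have h1 : ∑ h ∈ B ∪ B.image (s * ·), ζ x h = 1 := by
    rw [← (hζ x).2.2]
    exact (Finset.sum_subset Finset.subset_union_left fun h _ hh => (hζ x).2.1 h hh).symm
  have h2 : ∑ h ∈ B ∪ B.image (s * ·), ζ (x * s) (s⁻¹ * h) = 1 := by
    rw [← (hζ (x * s)).2.2, ← Finset.sum_subset Finset.subset_union_right,
      Finset.sum_image fun a _ b _ h => mul_left_cancel h]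
    · simp
    · intro h _ hh
      exact (hζ _).2.1 _ fun hm => hh (Finset.mem_image.2 ⟨_, hm, by simp⟩)
  calc variation B ζ x s ≤ ∑ h ∈ B ∪ B.image (s * ·), (ζ x h + ζ (x * s) (s⁻¹ * h)) := by
        refine Finset.sum_le_sum fun h _ => (abs_sub _ _).trans (le_of_eq ?_)
        rw [abs_of_nonneg ((hζ _).1 _), abs_of_nonneg ((hζ _).1 _)]
    _ = 2 := by rw [Finset.sum_add_distrib, h1, h2]; norm_num

theorem variation_convex (B : Finset Γ) (ζ ξ : Γ → Γ → ℝ) (x s : Γ) {a b : ℝ} (ha : 0 ≤ a)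
    (hb : 0 ≤ b) : variation B (a • ζ + b • ξ) x s ≤ a * variation B ζ x s + b * variation B ξ x s := by
  simp only [variation, Finset.mul_sum, ← Finset.sum_add_distrib]
  refine Finset.sum_le_sum fun h _ => ?_
  simp only [Pi.add_apply, Pi.smul_apply, smul_eq_mul]
  rw [← abs_of_nonneg ha, ← abs_of_nonneg hb, ← abs_mul, ← abs_mul, abs_of_nonneg ha,
    abs_of_nonneg hb]
  refine le_trans (le_of_eq ?_) (abs_add_le _ _)
  congr 1
  ring

theorem exists_localProb_weighted_le {S : Finset Γ}
    (h : ∀ ε > (0 : ℝ), ∃ B : Finset Γ, ∀ (V : Finset Γ) (m : Γ → ℝ), (∀ x, 0 ≤ m x) →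
      ∃ R, IsSeparator S B V R ∧ ∑ x ∈ R, m x ≤ ε * ∑ x ∈ V, m x) {ε : ℝ} (hε : 0 < ε) :
    ∃ B : Finset Γ, ∀ (F : Finset Γ) (w : Γ → Γ → ℝ), (∀ x s, 0 ≤ w x s) → ∃ ζ ∈ localProb B,
      ∑ x ∈ F, ∑ s ∈ S, w x s * variation B ζ x s ≤ ε * ∑ x ∈ F, ∑ s ∈ S, w x s := by
  obtain ⟨B, hB⟩ := h (ε / 4) (by positivity)
  refine ⟨insert 1 (B.image (·⁻¹)), fun F w hw => ?_⟩
  set B' := insert 1 (B.image (·⁻¹)) with hB'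
  set V : Finset Γ := F ∪ (F ×ˢ S).image fun p => p.1 * p.2 with hV
  have hVl : ∀ x ∈ F, x ∈ V := fun x hx => Finset.mem_union_left _ hx
  have hVr : ∀ x ∈ F, ∀ s ∈ S, x * s ∈ V := fun x hx s hs =>
    Finset.mem_union_right _ (Finset.mem_image.2 ⟨(x, s), by simp [hx, hs], rfl⟩)
  set m : Γ → ℝ := fun y => ∑ x ∈ F, ∑ s ∈ S,
    w x s * ((if x = y then 1 else 0) + (if x * s = y then 1 else 0)) with hm
  have hmsum : ∀ R : Finset Γ, ∑ y ∈ R, m y = ∑ x ∈ F, ∑ s ∈ S,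
      w x s * ((if x ∈ R then 1 else 0) + (if x * s ∈ R then 1 else 0)) := by
    intro R
    simp only [hm]
    rw [Finset.sum_comm]
    refine Finset.sum_congr rfl fun x _ => ?_
    rw [Finset.sum_comm]
    refine Finset.sum_congr rfl fun s _ => ?_
    rw [← Finset.mul_sum, Finset.sum_add_distrib, Finset.sum_ite_eq, Finset.sum_ite_eq]
  obtain ⟨R, ⟨hRV, c, hc1, hc2⟩, hR⟩ := hB V m fun y => Finset.sum_nonneg fun x _ =>
    Finset.sum_nonneg fun s _ => mul_nonneg (hw x s) (by positivity)
  let p : Γ → Γ := fun x => if x ∈ V ∧ x ∉ R then x⁻¹ * c x else 1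
  have hp : ∀ x, p x ∈ B' := by
    intro x
    by_cases hx : x ∈ V ∧ x ∉ R
    · simp only [p, hx, not_false_eq_true, and_self, if_true, hB', Finset.mem_insert]
      exact Or.inr (Finset.mem_image.2 ⟨_, hc1 x hx.1 hx.2, by simp⟩)
    · simp only [p, hx, if_false, hB', Finset.mem_insert, true_or]
  let ζ : Γ → Γ → ℝ := fun x h => if h = p x then 1 else 0
  have hζ : ζ ∈ localProb B' := by
    intro x
    refine ⟨fun h => ?_, fun h hh => ?_, ?_⟩
    · simp only [ζ]; positivity
    · exact if_neg (by rintro rfl; exact hh (hp x))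
    · simp [ζ, hp x]
  refine ⟨ζ, hζ, ?_⟩
  have hvar : ∀ x ∈ F, ∀ s ∈ S, variation B' ζ x s ≤
      2 * ((if x ∈ R then 1 else 0) + (if x * s ∈ R then 1 else 0)) := by
    intro x hx s hs
    by_cases hxR : x ∈ R
    · rw [if_pos hxR]
      refine (variation_le_two hζ x s).trans ?_
      split_ifs <;> norm_num
    by_cases hxsR : x * s ∈ R
    · rw [if_pos hxsR]
      refine (variation_le_two hζ x s).trans ?_
      split_ifs; norm_num
    · rw [if_neg hxR, if_neg hxsR]
      refine le_of_eq ((Finset.sum_eq_zero fun h _ => ?_).trans (by norm_num))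
      have h1 := hc2 x (hVl x hx) hxR s hs (hVr x hx s hs) hxsR
      have h2 : (s⁻¹ * h = p (x * s)) ↔ h = p x := by
        simp only [p, hVl x hx, hVr x hx s hs, hxR, hxsR, not_false_eq_true, and_self, if_true, h1,
          mul_inv_rev, mul_assoc]
        exact mul_right_inj _
      simp [ζ, h2]
  calc _ ≤ ∑ x ∈ F, ∑ s ∈ S, w x s *
        (2 * ((if x ∈ R then 1 else 0) + (if x * s ∈ R then 1 else 0))) :=
        Finset.sum_le_sum fun x hx => Finset.sum_le_sum fun s hs =>
          mul_le_mul_of_nonneg_left (hvar x hx s hs) (hw x s)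
    _ = 2 * ∑ y ∈ R, m y := by
        rw [hmsum, Finset.mul_sum]
        refine Finset.sum_congr rfl fun x _ => ?_
        rw [Finset.mul_sum]
        refine Finset.sum_congr rfl fun s _ => ?_
        ring
    _ ≤ 2 * (ε / 4 * ∑ y ∈ V, m y) := by linarith
    _ = ε * ∑ x ∈ F, ∑ s ∈ S, w x s := by
        have : ∑ y ∈ V, m y = 2 * ∑ x ∈ F, ∑ s ∈ S, w x s := by
          rw [hmsum, Finset.mul_sum]
          refine Finset.sum_congr rfl fun x hx => ?_
          rw [Finset.mul_sum]
          refine Finset.sum_congr rfl fun s hs => ?_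
          rw [if_pos (hVl x hx), if_pos (hVr x hx s hs)]
          ring
        rw [this]; ring

theorem exists_localProb_variation_le {S B : Finset Γ} {ε : ℝ} (hε : 0 < ε) (F : Finset Γ)
    (h : ∀ (w : Γ → Γ → ℝ), (∀ x s, 0 ≤ w x s) → ∃ ζ ∈ localProb B,
      ∑ x ∈ F, ∑ s ∈ S, w x s * variation B ζ x s ≤ ε * ∑ x ∈ F, ∑ s ∈ S, w x s) :
    ∃ ζ ∈ localProb B, ∀ x ∈ F, ∀ s ∈ S, variation B ζ x s ≤ 2 * ε := by
  by_contra! hcon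
  let ι := ↥(F ×ˢ S)
  let s : Set (ι → ℝ) := Set.univ.pi fun _ => Set.Iio (2 * ε)
  let t : Set (ι → ℝ) := {v | ∃ ζ ∈ localProb B, ∀ i : ι, variation B ζ i.1.1 i.1.2 ≤ v i}
  have hs1 : Convex ℝ s := convex_pi fun _ _ => convex_Iio _
  have hs2 : IsOpen s := isOpen_set_pi Set.finite_univ fun _ _ => isOpen_Iio
  have ht : Convex ℝ t := by
    rintro v ⟨ζ, hζ, hv⟩ v' ⟨ζ', hζ', hv'⟩ a b ha hb hab
    refine ⟨a • ζ + b • ζ', fun x => ⟨fun g => ?_, fun g hg => ?_, ?_⟩, fun i => ?_⟩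
    · exact add_nonneg (mul_nonneg ha ((hζ x).1 g)) (mul_nonneg hb ((hζ' x).1 g))
    · simp [(hζ x).2.1 g hg, (hζ' x).2.1 g hg]
    · simp only [Pi.add_apply, Pi.smul_apply, smul_eq_mul, Finset.sum_add_distrib,
        ← Finset.mul_sum, (hζ x).2.2, (hζ' x).2.2, mul_one, hab]
    · refine (variation_convex B ζ ζ' _ _ ha hb).trans ?_
      exact add_le_add (mul_le_mul_of_nonneg_left (hv i) ha) (mul_le_mul_of_nonneg_left (hv' i) hb)
  have hdisj : Disjoint s t := by
    refine Set.disjoint_left.2 ?_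
    rintro v hv ⟨ζ, hζ, hvt⟩
    obtain ⟨x, hx, g, hg, hlt⟩ := hcon ζ hζ
    have h1 := hvt ⟨(x, g), by simp [hx, hg]⟩
    have h2 := hv ⟨(x, g), by simp [hx, hg]⟩ (Set.mem_univ _)
    exact absurd (h1.trans_lt h2) (not_lt.2 hlt.le)
  obtain ⟨f, u, hfs, hft⟩ := geometric_hahn_banach_open hs1 hs2 ht hdisj
  let W : ι → ℝ := fun i => f (Pi.single i 1)
  have hf : ∀ v : ι → ℝ, f v = ∑ i, v i * W i := by
    intro v
    conv_lhs => rw [pi_eq_sum_univ' v]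
    rw [map_sum]
    refine Finset.sum_congr rfl fun i _ => ?_
    rw [map_smul, smul_eq_mul]
  obtain ⟨ζ₀, hζ₀, -⟩ := h (fun _ _ => 0) fun _ _ => le_rfl
  have hW : ∀ i, 0 ≤ W i := by
    intro i
    by_contra! hneg
    set v₀ : ι → ℝ := fun i => variation B ζ₀ i.1.1 i.1.2 with hv₀
    set k : ℝ := max 0 ((u - f v₀) / W i + 1)
    have hk1 : (u - f v₀) / W i < k := (lt_add_one _).trans_le (le_max_right _ _)
    have hk0 : 0 ≤ k := le_max_left _ _
    have h1 : u ≤ f (v₀ + k • Pi.single i 1) := by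
      refine hft _ ⟨ζ₀, hζ₀, fun j => ?_⟩
      simp only [hv₀, Pi.add_apply, Pi.smul_apply, smul_eq_mul]
      refine le_add_of_nonneg_right (mul_nonneg hk0 ?_)
      rw [Pi.single_apply]
      split_ifs <;> norm_num
    rw [map_add, map_smul, smul_eq_mul] at h1
    rw [div_lt_iff_of_neg hneg] at hk1
    change u ≤ f v₀ + k * W i at h1
    linarith
  set w : Γ → Γ → ℝ := fun x g => if hxg : (x, g) ∈ F ×ˢ S then W ⟨(x, g), hxg⟩ else 0 with hw
  have hsum : ∀ φ : Γ → Γ → ℝ, ∑ x ∈ F, ∑ g ∈ S, w x g * φ x g =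
      ∑ i : ι, W i * φ i.1.1 i.1.2 := by
    intro φ
    rw [← Finset.sum_product' (f := fun x g => w x g * φ x g), ← Finset.sum_coe_sort]
    refine Finset.sum_congr rfl fun i _ => ?_
    simp only [hw]
    rw [dif_pos i.2]
  obtain ⟨ζ, hζ, hle⟩ := h w fun x g => by
    simp only [hw]; split_ifs; exacts [hW _, le_rfl]
  have h1 := hsum fun _ _ => 1
  simp only [mul_one] at h1
  rw [hsum, h1] at hle
  have h2 := hfs (fun _ => ε) fun i _ => by simp only [Set.mem_Iio]; linarith
  have h3 := hft (fun i => variation B ζ i.1.1 i.1.2) ⟨ζ, hζ, fun i => le_rfl⟩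
  rw [hf] at h2 h3
  rw [← Finset.mul_sum] at h2
  simp only [mul_comm (variation _ _ _ _)] at h3
  linarith
theorem continuous_variation (B : Finset Γ) (x s : Γ) :
    Continuous fun ζ : Γ → Γ → ℝ => variation B ζ x s := by
  unfold variation
  fun_prop

omit [Group Γ] in
theorem isCompact_localProb (B : Finset Γ) : IsCompact (localProb B) := by
  have hcl : IsClosed (localProb B) := by
    simp only [localProb, Set.ofPred_forall, Set.ofPred_and]
    refine isClosed_iInter fun x => IsClosed.inter ?_ (IsClosed.inter ?_ ?_)
    · exact isClosed_iInter fun h => isClosed_le continuous_const (by fun_prop)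
    · exact isClosed_iInter fun h => isClosed_iInter fun _ =>
        isClosed_eq (by fun_prop) continuous_const
    · exact isClosed_eq (by fun_prop) continuous_const
  refine IsCompact.of_isClosed_subset (isCompact_univ_pi fun _ : Γ =>
    isCompact_univ_pi fun _ : Γ => isCompact_Icc (a := (0 : ℝ)) (b := 1)) hcl ?_
  intro ζ hζ x _ h _
  refine ⟨(hζ x).1 h, ?_⟩
  by_cases hh : h ∈ B
  · rw [← (hζ x).2.2]
    exact Finset.single_le_sum (fun g _ => (hζ x).1 g) hh
  · rw [(hζ x).2.1 h hh]; exact zero_le_one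

theorem isClosed_variation_le (B S : Finset Γ) (ε : ℝ) (x : Γ) :
    IsClosed {ζ : Γ → Γ → ℝ | ∀ s ∈ S, variation B ζ x s ≤ ε} := by
  simp only [Set.ofPred_forall]
  exact isClosed_iInter fun s => isClosed_iInter fun _ =>
    isClosed_le (continuous_variation B x s) continuous_const

theorem exists_localProb_forall_variation_le {S B : Finset Γ} {ε : ℝ}
    (h : ∀ F : Finset Γ, ∃ ζ ∈ localProb B, ∀ x ∈ F, ∀ s ∈ S, variation B ζ x s ≤ ε) :
    ∃ ζ ∈ localProb B, ∀ x, ∀ s ∈ S, variation B ζ x s ≤ ε := by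
  obtain ⟨ζ, hζ, hζ'⟩ := (isCompact_localProb B).inter_iInter_nonempty
    (fun x => {ζ : Γ → Γ → ℝ | ∀ s ∈ S, variation B ζ x s ≤ ε}) (isClosed_variation_le B S ε)
    fun F => by
      obtain ⟨ζ, hζ, hF⟩ := h F
      exact ⟨ζ, hζ, by simpa using hF⟩
  exact ⟨ζ, hζ, by simpa using hζ'⟩

theorem isExactGroup_of_localProb [Countable Γ]
    (h : ∀ (S : Finset Γ), (∀ s ∈ S, s⁻¹ ∈ S) → ∀ ε > (0 : ℝ), ∃ B : Finset Γ,
      ∃ ζ ∈ localProb B, ∀ x, ∀ s ∈ S, variation B ζ x s ≤ ε) : IsExactGroup Γ := by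
  obtain ⟨e, he⟩ := exists_surjective_nat Γ
  let S : ℕ → Finset Γ := fun n =>
    (Finset.range n).image e ∪ (Finset.range n).image fun k => (e k)⁻¹
  have hS : ∀ n, ∀ s ∈ S n, s⁻¹ ∈ S n := by
    intro n s hs
    simp only [S, Finset.mem_union, Finset.mem_image] at hs ⊢
    rcases hs with ⟨k, hk, rfl⟩ | ⟨k, hk, rfl⟩
    · exact Or.inr ⟨k, hk, rfl⟩
    · exact Or.inl ⟨k, hk, (inv_inv _).symm⟩
  choose B ζ₀ hζ₀ hζ₀' using fun n : ℕ => h (S n) (hS n) (1 / ((n : ℝ) + 1)) (by positivity)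
  let K : ℕ → Set (Γ → Γ → ℝ) := fun n =>
    localProb (B n) ∩ ⋂ x, {ζ | ∀ s ∈ S n, variation (B n) ζ x s ≤ 1 / ((n : ℝ) + 1)}
  have hK : ∀ n, IsCompact (K n) := fun n =>
    (isCompact_localProb _).inter_right (isClosed_iInter fun x => isClosed_variation_le _ _ _ x)
  have hKmem : ∀ n ζ, ζ ∈ K n ↔ ζ ∈ localProb (B n) ∧
      ∀ x, ∀ s ∈ S n, variation (B n) ζ x s ≤ 1 / ((n : ℝ) + 1) := fun n ζ => by
    simp [K]
  let X : Set (ℕ → Γ → Γ → ℝ) := Set.univ.pi K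
  have hX : IsCompact X := isCompact_univ_pi hK
  have : CompactSpace X := isCompact_iff_compactSpace.1 hX
  let a : Γ → X → X := fun γ Z => ⟨fun n x => Z.1 n (γ⁻¹ * x), fun n _ => by
    have hZ := (hKmem n _).1 (Z.2 n (Set.mem_univ n))
    refine (hKmem n _).2 ⟨fun x => hZ.1 _, fun x s hs => ?_⟩
    have := hZ.2 (γ⁻¹ * x) s hs
    simpa only [variation, mul_assoc] using this⟩
  have hcoord : ∀ n x, Continuous fun Z : X => Z.1 n x := fun n x =>
    (continuous_apply_apply n x).comp continuous_subtype_val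
  have ha : ∀ γ, Continuous (a γ) := by
    intro γ
    exact Continuous.subtype_mk (continuous_pi fun n => continuous_pi fun x => hcoord n _) _
  let φ := (Shrink.homeomorph.{0} X).symm
  refine ⟨Shrink.{0} X, inferInstance, fun γ Z => φ.symm (a γ (φ Z)), ?_, ?_, ?_, ?_, ?_, ?_, ?_⟩
  · exact ⟨φ.symm ⟨ζ₀, fun n _ => (hKmem n _).2 ⟨hζ₀ n, hζ₀' n⟩⟩⟩
  · exact φ.symm.compactSpace
  · exact φ.isEmbedding.metrizableSpace
  · intro Z
    rw [φ.symm_apply_eq]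
    ext n x h
    simp [a]
  · intro γ δ Z
    beta_reduce
    rw [φ.apply_symm_apply]
    congr 1
    ext n x h
    simp [a, mul_assoc]
  · intro γ
    exact φ.symm.continuous.comp ((ha γ).comp φ.continuous)
  · have hmem : ∀ n (Z : Shrink.{0} X), (φ Z).1 n ∈ localProb (B n) := fun n Z =>
      ((hKmem n _).1 ((φ Z).2 n (Set.mem_univ n))).1
    refine ⟨fun n Z g => (φ Z).1 n 1 g, fun n Z g => (hmem n Z 1).1 g, fun n Z => ?_,
      fun n g => ?_, fun γ ε hε => ?_⟩
    · rw [tsum_eq_sum (hmem n Z 1).2.1]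
      exact (hmem n Z 1).2.2
    · have h1 : Continuous fun Z : X => Z.1 n 1 g :=
        (continuous_apply g).comp (hcoord n 1)
      exact h1.comp φ.continuous
    · obtain ⟨k, rfl⟩ := he γ
      obtain ⟨N, hN⟩ := exists_nat_one_div_lt hε
      refine ⟨max N (k + 1), fun n hn Z => ?_⟩
      have hks : e k ∈ S n := by
        refine Finset.mem_union_left _ (Finset.mem_image.2 ⟨k, ?_, rfl⟩)
        have := (le_max_right N (k + 1)).trans hn
        simp; omega
      have h1 := ((hKmem n _).1 ((φ Z).2 n (Set.mem_univ n))).2 (e k)⁻¹ (e k) hks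
      rw [← tsum_eq_variation (hmem n Z)] at h1
      have h2 : (1 : ℝ) / (n + 1) ≤ 1 / (N + 1) := by
        have : (N : ℝ) ≤ n := by exact_mod_cast (le_max_left N (k + 1)).trans hn
        gcongr
      refine lt_of_le_of_lt (le_of_eq ?_) ((h1.trans h2).trans_lt hN)
      refine tsum_congr fun g => ?_
      beta_reduce
      rw [φ.apply_symm_apply, abs_sub_comm]
      simp [a]

/-- If every finite subset of a countable group has small subsets with relatively small boundary,
uniformly, then the group is exact. -/
theorem isExactGroup_of_locallyAmenable [Countable Γ]
    (h : ∀ (S : Finset Γ), (∀ s ∈ S, s⁻¹ ∈ S) → ∀ ε > (0 : ℝ), ∃ B : Finset Γ,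
      ∀ F : Finset Γ, F.Nonempty → ∃ E ⊆ F, E.Nonempty ∧ (∃ g, ∀ x ∈ E, g⁻¹ * x ∈ B) ∧
        ((outerBoundary S F E).card : ℝ) ≤ ε * E.card) : IsExactGroup Γ := by
  refine isExactGroup_of_localProb fun S hS ε hε => ?_
  obtain ⟨B, hB⟩ := exists_localProb_weighted_le
    (fun ε' hε' => exists_isSeparator_weight_le hS (h S hS) hε') (half_pos hε)
  refine ⟨B, exists_localProb_forall_variation_le fun F => ?_⟩
  obtain ⟨ζ, hζ, hle⟩ := exists_localProb_variation_le (half_pos hε) F (hB F)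
  exact ⟨ζ, hζ, fun x hx s hs => (hle x hx s hs).trans (by linarith)⟩

end Exactness

section RandomTilings

open scoped Classical

theorem mul_sum_le_sum_abs_sub {S F : Finset Γ} {p : Γ → Prop} {ε : ℝ}
    (hF : ∀ E ⊆ F, E.Nonempty → (∀ x ∈ E, p x) → ε * E.card ≤ (outerBoundary S F E).card)
    (f : Γ → ℝ) (hf : ∀ x, 0 ≤ f x) (hfp : ∀ x, f x ≠ 0 → x ∈ F ∧ p x) :
    ε * ∑ x ∈ F, f x ≤ ∑ x ∈ F, ∑ s ∈ S, if x * s ∈ F then |f x - f (x * s)| else 0 := by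
  induction hn : (F.filter fun x => f x ≠ 0).card using Nat.strong_induction_on generalizing f with
  | _ n ih =>
  set E := F.filter fun x => f x ≠ 0 with hE
  have hmemE : ∀ x, x ∈ E ↔ f x ≠ 0 := fun x => by
    simp only [hE, Finset.mem_filter]
    exact ⟨fun h => h.2, fun h => ⟨(hfp x h).1, h⟩⟩
  rcases E.eq_empty_or_nonempty with hE0 | hE1
  · have h0 : ∀ x, f x = 0 := fun x => by
      by_contra hx
      simpa [hE0] using (hmemE x).2 hx
    simp [h0]
  obtain ⟨a, haE, ha⟩ := E.exists_min_image f hE1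
  have hapos : 0 < f a := (hf a).lt_of_ne' ((hmemE a).1 haE)
  set f' : Γ → ℝ := fun x => if x ∈ E then f x - f a else 0 with hf'
  have hff' : ∀ x, f x = f' x + f a * (if x ∈ E then 1 else 0) := by
    intro x
    by_cases hx : x ∈ E
    · simp [hf', hx]
    · have : f x = 0 := by
        by_contra h
        exact hx ((hmemE x).2 h)
      simp [hf', hx, this]
  have hf'0 : ∀ x, 0 ≤ f' x := by
    intro x
    simp only [hf']
    split_ifs with hx
    · exact sub_nonneg.2 (ha x hx)
    · exact le_rfl
  have hf'E : ∀ x, f' x ≠ 0 → x ∈ E := fun x hx => by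
    by_contra h
    exact hx (if_neg h)
  have hlt : (F.filter fun x => f' x ≠ 0).card < n := by
    rw [← hn]
    refine Finset.card_lt_card (Finset.ssubset_iff_subset_ne.2 ⟨fun x hx => ?_, fun heq => ?_⟩)
    · exact hf'E x (Finset.mem_filter.1 hx).2
    · have := heq ▸ haE
      exact (Finset.mem_filter.1 this).2 (by simp [hf', haE])
  have hih := ih _ hlt f' hf'0 (fun x hx => hfp x ((hmemE x).1 (hf'E x hx))) rfl
  have hedge : ∀ x y, |f x - f y| =
      |f' x - f' y| + f a * |(if x ∈ E then (1 : ℝ) else 0) - (if y ∈ E then 1 else 0)| := by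
    intro x y
    rw [hff' x, hff' y]
    by_cases hx : x ∈ E <;> by_cases hy : y ∈ E
    · simp [hx, hy]
    · have h1 : f' y = 0 := if_neg hy
      simp only [hx, hy, h1, if_true, if_false]
      rw [abs_of_nonneg (by linarith [hf'0 x]), abs_of_nonneg (by linarith [hf'0 x])]
      simp
    · have h1 : f' x = 0 := if_neg hx
      simp only [hx, hy, h1, if_true, if_false]
      rw [abs_of_nonpos (by linarith [hf'0 y]), abs_of_nonpos (by linarith [hf'0 y])]
      simp
    · simp [hx, hy]
  have hsumE : ∑ x ∈ F, (if x ∈ E then (1 : ℝ) else 0) = E.card := by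
    rw [Finset.sum_ite_mem, Finset.inter_eq_right.2 (Finset.filter_subset _ _),
      Finset.sum_const, nsmul_eq_mul, mul_one]
  have hbd : ((outerBoundary S F E).card : ℝ) ≤ ∑ x ∈ F, ∑ s ∈ S, if x * s ∈ F then
      |(if x ∈ E then (1 : ℝ) else 0) - (if x * s ∈ E then 1 else 0)| else 0 := by
    rw [Finset.card_eq_sum_ones, Nat.cast_sum, outerBoundary, Finset.sum_filter]
    refine Finset.sum_le_sum fun x _ => ?_
    have hnn : ∀ s ∈ S, 0 ≤ if x * s ∈ F then
        |(if x ∈ E then (1 : ℝ) else 0) - (if x * s ∈ E then 1 else 0)| else 0 := by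
      intro s _
      split_ifs <;> simp
    by_cases hx : x ∉ E ∧ ∃ s ∈ S, x * s ∈ E
    · rw [if_pos hx]
      obtain ⟨hxE, s, hs, hxs⟩ := hx
      refine le_trans (le_of_eq ?_) (Finset.single_le_sum hnn hs)
      have hxsF : x * s ∈ F := (Finset.mem_filter.1 hxs).1
      simp [hxE, hxs, hxsF]
    · rw [if_neg hx]
      exact Finset.sum_nonneg hnn
  have hFE := hF E (Finset.filter_subset _ _) hE1 fun x hx => (hfp x ((hmemE x).1 hx)).2
  calc ε * ∑ x ∈ F, f x = ε * ∑ x ∈ F, f' x + f a * (ε * E.card) := by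
        rw [Finset.sum_congr rfl fun x _ => hff' x, Finset.sum_add_distrib, ← Finset.mul_sum, hsumE]
        ring
    _ ≤ _ := add_le_add hih (mul_le_mul_of_nonneg_left (hFE.trans hbd) hapos.le)
    _ = _ := by
        rw [Finset.mul_sum, ← Finset.sum_add_distrib]
        refine Finset.sum_congr rfl fun x _ => ?_
        rw [Finset.mul_sum, ← Finset.sum_add_distrib]
        refine Finset.sum_congr rfl fun s _ => ?_
        by_cases h : x * s ∈ F
        · rw [if_pos h, if_pos h, if_pos h, hedge]
        · simp [h]

theorem mul_card_le_sum_variation {S F G K Z : Finset Γ} {ε : ℝ} (hGF : G ⊆ F)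
    (hF : ∀ E ⊆ F, E.Nonempty → (∃ g, ∀ x ∈ E, x⁻¹ * g ∈ K) →
      ε * E.card ≤ (outerBoundary S F E).card)
    (ξ : Γ → Γ → ℝ) (hξ : ∀ x z, 0 ≤ ξ x z) (hξK : ∀ x z, ξ x z ≠ 0 → x⁻¹ * z ∈ K)
    (hξZ : ∀ x ∈ F, ∑ z ∈ Z, ξ x z = 1) :
    ε * G.card ≤ (∑ x ∈ G, ∑ s ∈ S, if x * s ∈ G then ∑ z ∈ Z, |ξ x z - ξ (x * s) z| else 0) +
      2 * S.card * (F \ G).card := by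
  let f : Γ → Γ → ℝ := fun z x => if x ∈ G then ξ x z else 0
  have hf : ∀ z x, 0 ≤ f z x := fun z x => by
    simp only [f]; split_ifs; exacts [hξ _ _, le_rfl]
  have hz : ∀ z, ε * ∑ x ∈ F, f z x ≤
      ∑ x ∈ F, ∑ s ∈ S, if x * s ∈ F then |f z x - f z (x * s)| else 0 := by
    intro z
    refine mul_sum_le_sum_abs_sub (p := fun x => x⁻¹ * z ∈ K)
      (fun E h1 h2 h3 => hF E h1 h2 ⟨z, h3⟩) (f z) (hf z) fun x hx => ?_
    have hxG : x ∈ G := by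
      by_contra h
      exact hx (if_neg h)
    exact ⟨hGF hxG, hξK x z (by simpa [f, hxG] using hx)⟩
  have hsum : ∑ z ∈ Z, ε * ∑ x ∈ F, f z x = ε * G.card := by
    rw [← Finset.mul_sum, Finset.sum_comm]
    congr 1
    have : ∀ x ∈ F, ∑ z ∈ Z, f z x = if x ∈ G then 1 else 0 := by
      intro x hx
      simp only [f]
      split_ifs
      · exact hξZ x hx
      · simp
    rw [Finset.sum_congr rfl this, Finset.sum_ite_mem, Finset.inter_eq_right.2 hGF]
    simp
  have hpt : ∀ x ∈ F, ∀ s ∈ S, (∑ z ∈ Z, if x * s ∈ F then |f z x - f z (x * s)| else 0) ≤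
      (if x ∈ G then if x * s ∈ G then ∑ z ∈ Z, |ξ x z - ξ (x * s) z| else 0 else 0) +
        ((if x ∈ F \ G then 1 else 0) + (if x * s ∈ F \ G then 1 else 0)) := by
    intro x hx s _
    have hle : ∀ y ∈ F, ∑ z ∈ Z, |ξ y z| = 1 := fun y hy => by
      rw [← hξZ y hy]
      exact Finset.sum_congr rfl fun z _ => abs_of_nonneg (hξ y z)
    by_cases hxs : x * s ∈ F
    · by_cases h1 : x ∈ G <;> by_cases h2 : x * s ∈ G
      · simp [f, h1, h2, hxs]
      · simp [f, h1, h2, hxs, hle x hx]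
      · simp [f, h1, h2, hxs, hx, hle _ hxs]
      · simp [f, h1, h2, hxs, hx]
    · have h2 : x * s ∉ G := fun h => hxs (hGF h)
      simp only [hxs, h2, if_false, Finset.sum_const_zero, Finset.mem_sdiff, false_and]
      split_ifs <;> norm_num
  have h1 : ∑ x ∈ F, ∑ s ∈ S, (if x ∈ F \ G then (1 : ℝ) else 0) = S.card * (F \ G).card := by
    rw [Finset.sum_comm, Finset.sum_const, nsmul_eq_mul, Finset.sum_ite_mem,
      Finset.inter_eq_right.2 Finset.sdiff_subset]
    simp
  have h2 : ∑ x ∈ F, ∑ s ∈ S, (if x * s ∈ F \ G then (1 : ℝ) else 0) ≤ S.card * (F \ G).card := by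
    rw [Finset.sum_comm, ← nsmul_eq_mul]
    refine Finset.sum_le_card_nsmul _ _ _ fun s _ => ?_
    rw [Finset.sum_boole]
    rw [← Finset.card_image_of_injective _ (mul_left_injective s)]
    refine Nat.cast_le.2 (Finset.card_le_card fun y hy => ?_)
    obtain ⟨x, hx, rfl⟩ := Finset.mem_image.1 hy
    exact (Finset.mem_filter.1 hx).2
  calc ε * G.card = ∑ z ∈ Z, ε * ∑ x ∈ F, f z x := hsum.symm
    _ ≤ ∑ z ∈ Z, ∑ x ∈ F, ∑ s ∈ S, (if x * s ∈ F then |f z x - f z (x * s)| else 0) :=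
        Finset.sum_le_sum fun z _ => hz z
    _ = ∑ x ∈ F, ∑ s ∈ S, ∑ z ∈ Z, (if x * s ∈ F then |f z x - f z (x * s)| else 0) := by
        rw [Finset.sum_comm]
        exact Finset.sum_congr rfl fun x _ => Finset.sum_comm
    _ ≤ _ := Finset.sum_le_sum fun x hx => Finset.sum_le_sum fun s hs => hpt x hx s hs
    _ ≤ _ := by
        simp only [Finset.sum_add_distrib]
        have h3 : ∑ x ∈ F, ∑ s ∈ S, (if x ∈ G then if x * s ∈ G then
            ∑ z ∈ Z, |ξ x z - ξ (x * s) z| else 0 else 0) =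
            ∑ x ∈ G, ∑ s ∈ S, if x * s ∈ G then ∑ z ∈ Z, |ξ x z - ξ (x * s) z| else 0 := by
          rw [← Finset.sum_subset hGF]
          · refine Finset.sum_congr rfl fun x hx => Finset.sum_congr rfl fun s _ => if_pos hx
          · intro x _ hx
            exact Finset.sum_eq_zero fun s _ => if_neg hx
        rw [h3, h1]
        linarith

/-- The shift action on subsets of `Γ`, coded by their indicators. -/
def shiftSet (γ : Γ) (P : Γ → Bool) : Γ → Bool := fun g => P (γ⁻¹ * g)

/-- The law of a random subset of `ι` containing each point independently with probability `p`. -/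
noncomputable def randomSet (ι : Type*) (p : unitInterval) : Measure (ι → Bool) :=
  Measure.infinitePi fun _ : ι => ProbabilityTheory.bernoulliMeasure true false p

instance {ι : Type*} (p : unitInterval) : IsProbabilityMeasure (randomSet ι p) := by
  unfold randomSet; infer_instance

theorem measurable_shiftSet (γ : Γ) : Measurable (shiftSet γ) :=
  measurable_pi_lambda _ fun _ => measurable_pi_apply _

theorem map_shiftSet_randomSet (p : unitInterval) (γ : Γ) :
    (randomSet Γ p).map (shiftSet γ) = randomSet Γ p := by
  have h := Measure.infinitePi_map_piCongrLeft
    (fun _ : Γ => ProbabilityTheory.bernoulliMeasure true false p) (Equiv.mulLeft γ)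
  have h2 : shiftSet γ = MeasurableEquiv.piCongrLeft (fun _ : Γ => Bool) (Equiv.mulLeft γ) := by
    funext P g
    obtain ⟨g, rfl⟩ := (Equiv.mulLeft γ).surjective g
    rw [MeasurableEquiv.piCongrLeft_apply_apply]
    simp [shiftSet]
  rw [h2]
  exact h

theorem randomSet_real_mem {ι : Type*} (p : unitInterval) (g : ι) :
    (randomSet ι p).real {P | P g = true} = p := by
  have h := Measure.infinitePi_pi
    (fun _ : ι => ProbabilityTheory.bernoulliMeasure true false p) (s := {g})
    (t := fun _ => {true}) (fun _ _ => measurableSet_singleton _)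
  have h2 : ((({g} : Finset ι) : Set ι).pi fun _ => ({true} : Set Bool)) =
      {P : ι → Bool | P g = true} := by
    ext P; simp
  rw [h2] at h
  rw [measureReal_def, randomSet, h]
  simp

theorem randomSet_real_mem_mem {ι : Type*} (p : unitInterval) {g g' : ι} (hg : g ≠ g') :
    (randomSet ι p).real {P | P g = true ∧ P g' = true} = (p : ℝ) ^ 2 := by
  have h := Measure.infinitePi_pi
    (fun _ : ι => ProbabilityTheory.bernoulliMeasure true false p) (s := {g, g'})
    (t := fun _ => {true}) (fun _ _ => measurableSet_singleton _)
  have h2 : ((({g, g'} : Finset ι) : Set ι).pi fun _ => ({true} : Set Bool)) =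
      {P : ι → Bool | P g = true ∧ P g' = true} := by
    ext P; simp [Set.pi]
  rw [h2] at h
  rw [measureReal_def, randomSet, h, Finset.prod_pair hg]
  simp [sq]

/-- The point `x` lies in the translate `g F` with `g ∈ P`, and in no other such translate. -/
def IsSoleCover (F : Finset Γ) (P : Γ → Bool) (g x : Γ) : Prop :=
  (P g = true ∧ g⁻¹ * x ∈ F) ∧ ∀ g', P g' = true → g'⁻¹ * x ∈ F → g' = g

theorem IsSoleCover.unique {F : Finset Γ} {P : Γ → Bool} {g g' x : Γ}
    (h : IsSoleCover F P g x) (h' : IsSoleCover F P g' x) : g' = g :=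
  h.2 g' h'.1.1 h'.1.2

theorem isSoleCover_shiftSet {F : Finset Γ} {P : Γ → Bool} {γ g x : Γ} :
    IsSoleCover F (shiftSet γ P) g x ↔ IsSoleCover F P (γ⁻¹ * g) (γ⁻¹ * x) := by
  unfold IsSoleCover shiftSet
  refine and_congr (by simp [mul_assoc]) ⟨fun h g' h1 h2 => ?_, fun h g' h1 h2 => ?_⟩
  · rw [← h (γ * g') (by simpa using h1) (by simpa [mul_assoc] using h2)]
    group
  · have := h (γ⁻¹ * g') h1 (by simpa [mul_assoc] using h2)
    exact mul_left_cancel this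

/-- The equivalence relation whose nontrivial classes are the sets of points covered exactly
once, grouped by the translate of `F` covering them. -/
noncomputable def tileRel (F : Finset Γ) (P : Γ → Bool) : EqRelSpace Γ :=
  ⟨fun q => decide (q.1 = q.2 ∨ ∃ g, IsSoleCover F P g q.1 ∧ IsSoleCover F P g q.2), by
    refine ⟨fun x => by simp, fun x y h => ?_, fun x y z h h' => ?_⟩
    · simp only [decide_eq_true_eq] at h ⊢
      exact h.imp Eq.symm fun ⟨g, h1, h2⟩ => ⟨g, h2, h1⟩
    · simp only [decide_eq_true_eq] at h h' ⊢
      rcases h with rfl | ⟨g, h1, h2⟩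
      · exact h'
      · rcases h' with rfl | ⟨g', h1', h2'⟩
        · exact Or.inr ⟨g, h1, h2⟩
        · rw [h2.unique h1'] at h2'
          exact Or.inr ⟨g, h1, h2'⟩⟩

theorem tileRel_apply {F : Finset Γ} {P : Γ → Bool} {x y : Γ} :
    (tileRel F P).1 (x, y) = true ↔ x = y ∨ ∃ g, IsSoleCover F P g x ∧ IsSoleCover F P g y := by
  simp [tileRel]

theorem tileRel_shiftSet (F : Finset Γ) (γ : Γ) (P : Γ → Bool) :
    tileRel F (shiftSet γ P) = shiftE γ (tileRel F P) := by
  refine Subtype.ext (funext fun ⟨x, y⟩ => Bool.eq_iff_iff.2 ?_)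
  change (tileRel F (shiftSet γ P)).1 (x, y) = true ↔
    (tileRel F P).1 (γ⁻¹ * x, γ⁻¹ * y) = true
  simp only [tileRel_apply, isSoleCover_shiftSet, mul_right_inj]
  exact or_congr Iff.rfl ((Equiv.mulLeft γ⁻¹).surjective.exists
    (p := fun g => IsSoleCover F P g (γ⁻¹ * x) ∧ IsSoleCover F P g (γ⁻¹ * y))).symm

theorem finite_classOf_tileRel (F : Finset Γ) (P : Γ → Bool) (x : Γ) :
    (classOf (tileRel F P) x).Finite := by
  refine (insert x ((F ×ˢ F).image fun q => x * q.1⁻¹ * q.2)).finite_toSet.subset fun y hy => ?_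
  rcases tileRel_apply.1 hy with rfl | ⟨g, h1, h2⟩
  · simp
  · refine Finset.mem_coe.2 (Finset.mem_insert_of_mem (Finset.mem_image.2
      ⟨(g⁻¹ * x, g⁻¹ * y), Finset.mem_product.2 ⟨h1.1.2, h2.1.2⟩, by group⟩))

theorem Measurable.eq_true {α : Type*} [MeasurableSpace α] {f : α → Bool} (hf : Measurable f) :
    Measurable fun a => f a = true :=
  (measurable_from_top (f := fun b : Bool => b = true)).comp hf

theorem measurable_isSoleCover [Countable Γ] (F : Finset Γ) (g x : Γ) :
    Measurable fun P => IsSoleCover F P g x := by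
  unfold IsSoleCover
  have h : ∀ g : Γ, Measurable fun P : Γ → Bool => P g = true := fun g =>
    (measurable_pi_apply g).eq_true
  refine ((h g).and measurable_const).and (Measurable.forall fun g' => ?_)
  exact (h g').imp (measurable_const.imp measurable_const)

theorem measurable_tileRel [Countable Γ] (F : Finset Γ) : Measurable (tileRel F) := by
  refine Measurable.subtype_mk (measurable_pi_lambda _ fun q => measurable_to_bool ?_)
  have : Measurable fun P => q.1 = q.2 ∨ ∃ g, IsSoleCover F P g q.1 ∧ IsSoleCover F P g q.2 :=
    measurable_const.or (Measurable.exists fun g =>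
      (measurable_isSoleCover F g q.1).and (measurable_isSoleCover F g q.2))
  convert measurableSet_setOfPred.2 this using 1
  ext P
  simp

theorem shiftE_shiftE (γ δ : Γ) (r : EqRelSpace Γ) : shiftE γ (shiftE δ r) = shiftE (γ * δ) r := by
  refine Subtype.ext (funext fun q => ?_)
  simp [shiftE, mul_assoc]

theorem continuous_shiftE (γ : Γ) : Continuous (shiftE γ : EqRelSpace Γ → EqRelSpace Γ) :=
  Continuous.subtype_mk (continuous_pi fun q =>
    (continuous_apply (γ⁻¹ * q.1, γ⁻¹ * q.2)).comp continuous_subtype_val) _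

theorem measurable_shiftE (γ : Γ) : Measurable (shiftE γ : EqRelSpace Γ → EqRelSpace Γ) :=
  Measurable.subtype_mk (measurable_pi_lambda _ fun q =>
    (measurable_pi_apply (γ⁻¹ * q.1, γ⁻¹ * q.2)).comp measurable_subtype_coe)

/-- The law of the random tiling relation of `F` with density `p`. -/
noncomputable def tileLaw [Countable Γ] (F : Finset Γ) (p : unitInterval) :
    ProbabilityMeasure (EqRelSpace Γ) :=
  ⟨(randomSet Γ p).map (tileRel F),
    Measure.isProbabilityMeasure_map (measurable_tileRel F).aemeasurable⟩

theorem isFIRE_tileLaw [Countable Γ] (F : Finset Γ) (p : unitInterval) :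
    IsFIRE (tileLaw F p) := by
  refine ⟨fun γ => ?_, ?_⟩
  · change ((randomSet Γ p).map (tileRel F)).map (shiftE γ) = (randomSet Γ p).map (tileRel F)
    rw [Measure.map_map (measurable_shiftE γ) (measurable_tileRel F)]
    have : shiftE γ ∘ tileRel F = tileRel F ∘ shiftSet γ :=
      funext fun P => (tileRel_shiftSet F γ P).symm
    rw [this, ← Measure.map_map (measurable_tileRel F) (measurable_shiftSet γ),
      map_shiftSet_randomSet]
  · have hm : Measurable fun r : EqRelSpace Γ => ∀ g, (classOf r g).Finite := by
      have : ∀ (r : EqRelSpace Γ) (g : Γ), (classOf r g).Finite ↔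
          ∃ A : Finset Γ, ∀ h, r.1 (g, h) = true → h ∈ A := fun r g =>
        ⟨fun hf => ⟨hf.toFinset, fun h hh => hf.mem_toFinset.2 hh⟩,
          fun ⟨A, hA⟩ => A.finite_toSet.subset hA⟩
      simp only [this]
      refine Measurable.forall fun g => Measurable.exists fun A => Measurable.forall fun h =>
        Measurable.imp ?_ measurable_const
      exact ((measurable_pi_apply (g, h)).comp measurable_subtype_coe).eq_true
    exact (ae_map_iff (measurable_tileRel F).aemeasurable (measurableSet_setOfPred.2 hm)).2
      (Filter.Eventually.of_forall fun P g => finite_classOf_tileRel F P g)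

/-- A measurable assignment of a probability measure on `Γ` to every equivalence relation. -/
structure IsProbField (u : EqRelSpace Γ → Γ → ℝ) : Prop where
  measurable : ∀ g, Measurable fun r => u r g
  nonneg : ∀ r g, 0 ≤ u r g
  tsum_eq_one : ∀ r, ∑' g, u r g = 1

namespace IsProbField

variable {u : EqRelSpace Γ → Γ → ℝ}

theorem summable {α : Type*} {u : EqRelSpace α → α → ℝ} (hu : IsProbField u) (r : EqRelSpace α) : Summable (u r) := by
  by_contra h
  simpa [tsum_eq_zero_of_not_summable h] using hu.tsum_eq_one r

theorem summable_mul_left (hu : IsProbField u) (r : EqRelSpace Γ) (s : Γ) :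
    Summable fun h => u r (s * h) :=
  (Equiv.mulLeft s).summable_iff.2 (hu.summable r)

theorem tsum_mul_left (hu : IsProbField u) (r : EqRelSpace Γ) (s : Γ) :
    ∑' h, u r (s * h) = 1 := by
  rw [← hu.tsum_eq_one r]
  exact (Equiv.mulLeft s).tsum_eq (u r)

theorem summable_abs_sub (hu : IsProbField u) (r r' : EqRelSpace Γ) (s : Γ) :
    Summable fun h => |u r (s * h) - u r' h| :=
  ((hu.summable_mul_left r s).sub (hu.summable r')).abs

theorem tsum_abs_sub_le (hu : IsProbField u) (r r' : EqRelSpace Γ) (s : Γ) :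
    ∑' h, |u r (s * h) - u r' h| ≤ 2 := by
  calc _ ≤ ∑' h, (u r (s * h) + u r' h) := by
        refine (hu.summable_abs_sub r r' s).tsum_le_tsum (fun h => ?_)
          ((hu.summable_mul_left r s).add (hu.summable r'))
        rw [abs_le]
        constructor <;> linarith [hu.nonneg r (s * h), hu.nonneg r' h]
    _ = 2 := by
        rw [(hu.summable_mul_left r s).tsum_add (hu.summable r'), hu.tsum_mul_left,
          hu.tsum_eq_one]
        norm_num

end IsProbField

/-- The failure of `u` to be equivariant at the identity along the edges of `r` labelled by `S`. -/
noncomputable def equivDefect (S : Finset Γ) (u : EqRelSpace Γ → Γ → ℝ) (r : EqRelSpace Γ) : ℝ :=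
  ∑ s ∈ S, if r.1 (1, s) = true then ∑' h, |u r (s * h) - u (shiftE s⁻¹ r) h| else 0

theorem equivDefect_nonneg (S : Finset Γ) (u : EqRelSpace Γ → Γ → ℝ) (r : EqRelSpace Γ) :
    0 ≤ equivDefect S u r := by
  refine Finset.sum_nonneg fun s _ => ?_
  split_ifs
  exacts [tsum_nonneg fun _ => abs_nonneg _, le_rfl]

theorem equivDefect_le (S : Finset Γ) {u : EqRelSpace Γ → Γ → ℝ} (hu : IsProbField u)
    (r : EqRelSpace Γ) : equivDefect S u r ≤ 2 * S.card := by
  rw [mul_comm, ← nsmul_eq_mul]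
  refine Finset.sum_le_card_nsmul _ _ _ fun s _ => ?_
  split_ifs
  exacts [hu.tsum_abs_sub_le _ _ _, by norm_num]

theorem Measurable.tsum_abs {α ι : Type*} [MeasurableSpace α] [Countable ι] {f : ι → α → ℝ}
    (hf : ∀ i, Measurable (f i)) : Measurable fun a => ∑' i, |f i a| := by
  have h : ∀ a, ∑' i, |f i a| = (∑' i, ENNReal.ofReal |f i a|).toReal := fun a => by
    rw [ENNReal.tsum_toReal_eq fun i => ENNReal.ofReal_ne_top]
    simp
  simp only [h]
  exact (Measurable.tsum fun i => (hf i).abs.ennreal_ofReal).ennreal_toReal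

theorem measurable_apply_eq_true {α : Type*} (x y : α) :
    Measurable fun r : EqRelSpace α => r.1 (x, y) = true :=
  ((measurable_pi_apply (x, y)).comp measurable_subtype_coe).eq_true

theorem measurable_equivDefect [Countable Γ] (S : Finset Γ) {u : EqRelSpace Γ → Γ → ℝ}
    (hu : IsProbField u) : Measurable (equivDefect S u) := by
  refine Finset.measurable_fun_sum _ fun s _ => ?_
  refine Measurable.ite (measurableSet_setOfPred.2 (measurable_apply_eq_true 1 s)) ?_
    measurable_const
  exact Measurable.tsum_abs fun h =>
    (hu.measurable _).sub ((hu.measurable _).comp (measurable_shiftE _))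

theorem equivDefect_shiftE (S : Finset Γ) (u : EqRelSpace Γ → Γ → ℝ) (r : EqRelSpace Γ) (x : Γ) :
    equivDefect S u (shiftE x⁻¹ r) = ∑ s ∈ S, if r.1 (x, x * s) = true then
      ∑' z, |u (shiftE x⁻¹ r) (x⁻¹ * z) - u (shiftE (x * s)⁻¹ r) ((x * s)⁻¹ * z)| else 0 := by
  refine Finset.sum_congr rfl fun s _ => ?_
  have h1 : (shiftE x⁻¹ r).1 (1, s) = r.1 (x, x * s) := by simp [shiftE]
  rw [h1, shiftE_shiftE, ← mul_inv_rev]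
  congr 1
  rw [← (Equiv.mulLeft (x * s)).tsum_eq fun z =>
    |u (shiftE x⁻¹ r) (x⁻¹ * z) - u (shiftE (x * s)⁻¹ r) ((x * s)⁻¹ * z)|]
  refine tsum_congr fun h => ?_
  simp [mul_assoc]

theorem sum_le_equivDefect_shiftE (S Z : Finset Γ) {u : EqRelSpace Γ → Γ → ℝ}
    (hu : IsProbField u) (r : EqRelSpace Γ) (x : Γ) :
    (∑ s ∈ S, if r.1 (x, x * s) = true then
      ∑ z ∈ Z, |u (shiftE x⁻¹ r) (x⁻¹ * z) - u (shiftE (x * s)⁻¹ r) ((x * s)⁻¹ * z)| else 0) ≤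
      equivDefect S u (shiftE x⁻¹ r) := by
  rw [equivDefect_shiftE]
  refine Finset.sum_le_sum fun s _ => ?_
  split_ifs
  · refine Summable.sum_le_tsum _ (fun _ _ => abs_nonneg _) ?_
    exact ((hu.summable_mul_left _ _).sub (hu.summable_mul_left _ _)).abs
  · exact le_rfl

theorem sum_isSoleCover_equivDefect_ge {S F K : Finset Γ} {ε : ℝ} (hε : 0 ≤ ε)
    (hF : ∀ E ⊆ F, E.Nonempty → (∃ g, ∀ x ∈ E, x⁻¹ * g ∈ K) →
      ε * E.card ≤ (outerBoundary S F E).card)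
    {u : EqRelSpace Γ → Γ → ℝ} (hu : IsProbField u) (huK : ∀ r g, g ∉ K → u r g = 0)
    (P : Γ → Bool) :
    (if P 1 = true then ε * F.card else 0) - (ε + 2 * S.card) *
        ∑ x ∈ F, ∑ y ∈ F, (if y ≠ x then if P 1 = true ∧ P (x * y⁻¹) = true then (1 : ℝ) else 0
          else 0) ≤
      ∑ x ∈ F, if IsSoleCover F P 1 x then equivDefect S u (shiftE x⁻¹ (tileRel F P)) else 0 := by
  have hnn : 0 ≤ ∑ x ∈ F,
      if IsSoleCover F P 1 x then equivDefect S u (shiftE x⁻¹ (tileRel F P)) else 0 := by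
    refine Finset.sum_nonneg fun x _ => ?_
    split_ifs
    exacts [equivDefect_nonneg _ _ _, le_rfl]
  by_cases hP : P 1 = true
  swap
  · simpa [hP] using hnn
  set r := tileRel F P with hr
  set G := F.filter fun x => IsSoleCover F P 1 x with hG
  have hrG : ∀ x ∈ G, ∀ y ∈ G, r.1 (x, y) = true := fun x hx y hy =>
    tileRel_apply.2 (Or.inr ⟨1, (Finset.mem_filter.1 hx).2, (Finset.mem_filter.1 hy).2⟩)
  have hkey := mul_card_le_sum_variation (S := S) (F := F) (G := G) (K := K)
    (Z := (F ×ˢ K).image fun q => q.1 * q.2) (ε := ε) (Finset.filter_subset _ _) hF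
    (fun x z => u (shiftE x⁻¹ r) (x⁻¹ * z)) (fun x z => hu.nonneg _ _)
    (fun x z h => by
      by_contra h'
      exact h (huK _ _ h'))
    (fun x hx => by
      rw [← hu.tsum_mul_left (shiftE x⁻¹ r) x⁻¹]
      refine (tsum_eq_sum fun z hz => huK _ _ fun h => hz ?_).symm
      exact Finset.mem_image.2 ⟨(x, x⁻¹ * z), Finset.mem_product.2 ⟨hx, h⟩, by simp⟩)
  have hdef : (∑ x ∈ G, ∑ s ∈ S, if x * s ∈ G then
      ∑ z ∈ (F ×ˢ K).image fun q => q.1 * q.2,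
        |u (shiftE x⁻¹ r) (x⁻¹ * z) - u (shiftE (x * s)⁻¹ r) ((x * s)⁻¹ * z)| else 0) ≤
      ∑ x ∈ F, if IsSoleCover F P 1 x then equivDefect S u (shiftE x⁻¹ r) else 0 := by
    rw [← Finset.sum_filter]
    refine Finset.sum_le_sum fun x hx => le_trans (Finset.sum_le_sum fun s _ => ?_)
      (sum_le_equivDefect_shiftE S ((F ×ˢ K).image fun q => q.1 * q.2) hu r x)
    by_cases hs : x * s ∈ G
    · rw [if_pos hs, if_pos (hrG x hx _ hs)]
    · rw [if_neg hs]
      split_ifs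
      exacts [Finset.sum_nonneg fun _ _ => abs_nonneg _, le_rfl]
  have hcompl : ((F \ G).card : ℝ) ≤ ∑ x ∈ F, ∑ y ∈ F,
      (if y ≠ x then if P 1 = true ∧ P (x * y⁻¹) = true then (1 : ℝ) else 0 else 0) := by
    have hFG : F \ G = F.filter fun x => ¬ IsSoleCover F P 1 x := by
      rw [hG, Finset.filter_not]
    rw [hFG, ← Finset.sum_boole]
    refine Finset.sum_le_sum fun x hx => ?_
    have hnn : ∀ y ∈ F, 0 ≤
        if y ≠ x then if P 1 = true ∧ P (x * y⁻¹) = true then (1 : ℝ) else 0 else 0 := by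
      intro y _
      split_ifs <;> norm_num
    by_cases h : IsSoleCover F P 1 x
    · simpa only [h, not_true_eq_false, if_false] using Finset.sum_nonneg hnn
    · simp only [h, not_false_eq_true, if_true]
      have : ∃ g', P g' = true ∧ g'⁻¹ * x ∈ F ∧ g' ≠ 1 := by
        by_contra! hc
        exact h ⟨⟨hP, by simpa using hx⟩, fun g' h1 h2 => by
          exact hc g' h1 h2⟩
      obtain ⟨g', h1, h2, h3⟩ := this
      refine le_trans (le_of_eq ?_) (Finset.single_le_sum hnn h2)
      have h4 : g'⁻¹ * x ≠ x := by simpa using h3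
      simp [h1, hP, h3]
  have hcard : (G.card : ℝ) + (F \ G).card = F.card := by
    rw [add_comm]
    exact_mod_cast Finset.card_sdiff_add_card_eq_card (Finset.filter_subset _ _ : G ⊆ F)
  rw [if_pos hP]
  have hS : (0 : ℝ) ≤ S.card := Nat.cast_nonneg _
  have h5 := mul_le_mul_of_nonneg_left hcompl (by positivity : 0 ≤ ε + 2 * (S.card : ℝ))
  rw [← hcard]
  linarith

theorem integrable_ite_of_abs_le {α : Type*} [MeasurableSpace α] {μ : Measure α}
    [IsFiniteMeasure μ] {p : α → Prop} [DecidablePred p] {f : α → ℝ} {C : ℝ} (hp : Measurable p) (hf : Measurable f)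
    (hC : 0 ≤ C) (hfC : ∀ a, |f a| ≤ C) : Integrable (fun a => if p a then f a else 0) μ := by
  refine Integrable.of_bound (Measurable.ite (measurableSet_setOfPred.2 hp) hf
    measurable_const).aestronglyMeasurable C (Filter.Eventually.of_forall fun a => ?_)
  split_ifs
  exacts [hfC a, by simpa using hC]

theorem integral_ite_one {α : Type*} [MeasurableSpace α] {μ : Measure α} {p : α → Prop}
    [DecidablePred p] (hp : Measurable p) : ∫ a, (if p a then (1 : ℝ) else 0) ∂μ = μ.real {a | p a} := by
  rw [← integral_indicator_one (measurableSet_setOfPred.2 hp)]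
  congr with a
  simp [Set.indicator_apply]

theorem integral_equivDefect_tileRel_ge [Countable Γ] {S F K : Finset Γ} {ε : ℝ} (hε : 0 ≤ ε)
    (hF : ∀ E ⊆ F, E.Nonempty → (∃ g, ∀ x ∈ E, x⁻¹ * g ∈ K) →
      ε * E.card ≤ (outerBoundary S F E).card)
    {u : EqRelSpace Γ → Γ → ℝ} (hu : IsProbField u) (huK : ∀ r g, g ∉ K → u r g = 0)
    (p : unitInterval) :
    ε * F.card * p - (ε + 2 * S.card) * (F.card * p) ^ 2 ≤
      ∫ P, equivDefect S u (tileRel F P) ∂randomSet Γ p := by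
  set D : (Γ → Bool) → ℝ := fun P => equivDefect S u (tileRel F P) with hD
  have hDm : Measurable D := (measurable_equivDefect S hu).comp (measurable_tileRel F)
  have hDabs : ∀ P, |D P| ≤ 2 * S.card := fun P => by
    rw [abs_of_nonneg (equivDefect_nonneg _ _ _)]
    exact equivDefect_le S hu _
  have hS : (0 : ℝ) ≤ 2 * S.card := by positivity
  have hmem : ∀ g : Γ, Measurable fun P : Γ → Bool => P g = true := fun g =>
    (measurable_pi_apply g).eq_true
  have hDint : ∀ x, Integrable (fun P => if IsSoleCover F P x⁻¹ 1 then D P else 0)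
      (randomSet Γ p) := fun x =>
    integrable_ite_of_abs_le (measurable_isSoleCover F _ _) hDm hS hDabs
  have hDint' : Integrable D (randomSet Γ p) :=
    Integrable.of_bound hDm.aestronglyMeasurable _ (Filter.Eventually.of_forall hDabs)
  have hDint2 : ∀ x, Integrable (fun P => if IsSoleCover F P 1 x then D (shiftSet x⁻¹ P) else 0)
      (randomSet Γ p) := fun x =>
    integrable_ite_of_abs_le (measurable_isSoleCover F _ _)
      (hDm.comp (measurable_shiftSet _)) hS fun P => hDabs _
  have htransport : ∀ x, ∫ P, (if IsSoleCover F P x⁻¹ 1 then D P else 0) ∂randomSet Γ p =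
      ∫ P, (if IsSoleCover F P 1 x then D (shiftSet x⁻¹ P) else 0) ∂randomSet Γ p := by
    intro x
    conv_lhs => rw [← map_shiftSet_randomSet p x⁻¹]
    rw [integral_map (measurable_shiftSet _).aemeasurable
      (Measurable.ite (measurableSet_setOfPred.2 (measurable_isSoleCover F _ _)) hDm
        measurable_const).aestronglyMeasurable]
    simp only [isSoleCover_shiftSet]
    simp
  have hle : ∀ P, ∑ x ∈ F, (if IsSoleCover F P x⁻¹ 1 then D P else 0) ≤ D P := by
    intro P
    rw [← Finset.sum_filter, Finset.sum_const, nsmul_eq_mul]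
    refine mul_le_of_le_one_left (equivDefect_nonneg _ _ _) ?_
    have : (F.filter fun x => IsSoleCover F P x⁻¹ 1).card ≤ 1 :=
      Finset.card_le_one.2 fun a ha b hb =>
        inv_injective ((Finset.mem_filter.1 hb).2.unique (Finset.mem_filter.1 ha).2)
    exact_mod_cast this
  have hpair : ∀ x y : Γ, ∫ P, (if y ≠ x then if P 1 = true ∧ P (x * y⁻¹) = true then (1 : ℝ)
      else 0 else 0) ∂randomSet Γ p ≤ (p : ℝ) ^ 2 := by
    intro x y
    by_cases h : y = x
    · simp [h, sq_nonneg]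
    · simp only [ne_eq, h, not_false_eq_true, if_true]
      rw [integral_ite_one ((hmem _).and (hmem _)), randomSet_real_mem_mem]
      exact fun h' => h (mul_inv_eq_one.1 h'.symm).symm
  have hpairint : ∀ x y : Γ, Integrable (fun P : Γ → Bool => if y ≠ x then
      if P 1 = true ∧ P (x * y⁻¹) = true then (1 : ℝ) else 0 else 0) (randomSet Γ p) := by
    intro x y
    by_cases h : y = x
    · simp [h]
    · simp only [ne_eq, h, not_false_eq_true, if_true]
      exact integrable_ite_of_abs_le ((hmem _).and (hmem _)) measurable_const zero_le_one
        (fun _ => abs_one.le)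
  have hint1 : Integrable (fun P : Γ → Bool => if P 1 = true then ε * F.card else 0)
      (randomSet Γ p) :=
    integrable_ite_of_abs_le (hmem 1) measurable_const (abs_nonneg (ε * F.card)) fun _ => le_rfl
  have hI1 : ∫ P, (if P 1 = true then ε * F.card else 0) ∂randomSet Γ p = ε * F.card * p := by
    rw [← randomSet_real_mem p (1 : Γ), ← integral_ite_one (hmem 1), ← integral_const_mul]
    simp
  have hsumint : Integrable (fun P : Γ → Bool => ∑ x ∈ F, ∑ y ∈ F, if y ≠ x then
      if P 1 = true ∧ P (x * y⁻¹) = true then (1 : ℝ) else 0 else 0) (randomSet Γ p) :=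
    integrable_finsetSum _ fun x _ => integrable_finsetSum _ fun y _ => hpairint x y
  have hI2 : ∫ P, (∑ x ∈ F, ∑ y ∈ F, if y ≠ x then
      if P 1 = true ∧ P (x * y⁻¹) = true then (1 : ℝ) else 0 else 0) ∂randomSet Γ p ≤
      (F.card * p) ^ 2 := by
    rw [integral_finsetSum _ fun x _ => integrable_finsetSum _ fun y _ => hpairint x y]
    have h1 : ∀ x ∈ F, ∫ P, (∑ y ∈ F, if y ≠ x then
        if P 1 = true ∧ P (x * y⁻¹) = true then (1 : ℝ) else 0 else 0) ∂randomSet Γ p ≤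
        F.card * (p : ℝ) ^ 2 := by
      intro x _
      rw [integral_finsetSum _ fun y _ => hpairint x y, ← nsmul_eq_mul]
      exact Finset.sum_le_card_nsmul _ _ _ fun y _ => hpair x y
    refine (Finset.sum_le_card_nsmul _ _ _ h1).trans (le_of_eq ?_)
    rw [nsmul_eq_mul]
    ring
  calc ε * F.card * p - (ε + 2 * S.card) * (F.card * p) ^ 2
      ≤ ∫ P, ((if P 1 = true then ε * F.card else 0) - (ε + 2 * S.card) *
        ∑ x ∈ F, ∑ y ∈ F, (if y ≠ x then if P 1 = true ∧ P (x * y⁻¹) = true then (1 : ℝ) else 0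
          else 0)) ∂randomSet Γ p := by
        rw [integral_sub hint1 (hsumint.const_mul _), integral_const_mul, hI1]
        have := mul_le_mul_of_nonneg_left hI2 (add_nonneg hε hS)
        linarith
    _ ≤ ∫ P, ∑ x ∈ F, (if IsSoleCover F P 1 x then D (shiftSet x⁻¹ P) else 0) ∂randomSet Γ p := by
        refine integral_mono (hint1.sub (hsumint.const_mul _))
          (integrable_finsetSum _ fun x _ => hDint2 x) fun P => ?_
        simp only [hD, tileRel_shiftSet]
        exact sum_isSoleCover_equivDefect_ge hε hF hu huK P
    _ = ∫ P, ∑ x ∈ F, (if IsSoleCover F P x⁻¹ 1 then D P else 0) ∂randomSet Γ p := by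
        rw [integral_finsetSum _ fun x _ => hDint2 x, integral_finsetSum _ fun x _ => hDint x]
        exact Finset.sum_congr rfl fun x _ => (htransport x).symm
    _ ≤ _ := integral_mono (integrable_finsetSum _ fun x _ => hDint x) hDint' hle

theorem integral_equivDefect_tileLaw_ge [Countable Γ] {S F K : Finset Γ} {ε : ℝ} (hε : 0 ≤ ε)
    (hF : ∀ E ⊆ F, E.Nonempty → (∃ g, ∀ x ∈ E, x⁻¹ * g ∈ K) →
      ε * E.card ≤ (outerBoundary S F E).card)
    {u : EqRelSpace Γ → Γ → ℝ} (hu : IsProbField u) (huK : ∀ r g, g ∉ K → u r g = 0)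
    (p : unitInterval) :
    ε * F.card * p - (ε + 2 * S.card) * (F.card * p) ^ 2 ≤
      ∫ r, equivDefect S u r ∂(tileLaw F p).toMeasure := by
  refine (integral_equivDefect_tileRel_ge hε hF hu huK p).trans (le_of_eq ?_)
  exact (integral_map (measurable_tileRel F).aemeasurable
    (measurable_equivDefect S hu).aestronglyMeasurable).symm

/-- The nonnegative weights `b` on `K`, scaled down to total mass at most one, with the missing
mass placed at `1`. -/
noncomputable def normalizeAt (K : Finset Γ) (b : Γ → ℝ) (h : Γ) : ℝ :=
  (if h ∈ K then b h / max 1 (∑ k ∈ K, b k) else 0) +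
    if h = 1 then 1 - (∑ k ∈ K, b k) / max 1 (∑ k ∈ K, b k) else 0

theorem div_max_one_le_one (t : ℝ) : t / max 1 t ≤ 1 :=
  div_le_one_of_le₀ (le_max_right _ _) (by positivity)

theorem normalizeAt_nonneg {K : Finset Γ} {b : Γ → ℝ} (hb : ∀ h, 0 ≤ b h) (h : Γ) :
    0 ≤ normalizeAt K b h := by
  have h1 : 0 ≤ b h / max 1 (∑ k ∈ K, b k) := div_nonneg (hb h) (by positivity)
  have h2 := div_max_one_le_one (∑ k ∈ K, b k)
  unfold normalizeAt
  split_ifs <;> linarith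

theorem normalizeAt_eq_zero {K : Finset Γ} (hK : 1 ∈ K) {b : Γ → ℝ} {h : Γ} (hh : h ∉ K) :
    normalizeAt K b h = 0 := by
  have : h ≠ 1 := fun h' => hh (h' ▸ hK)
  simp [normalizeAt, hh, this]

theorem sum_normalizeAt {K : Finset Γ} (hK : 1 ∈ K) (b : Γ → ℝ) :
    ∑ h ∈ K, normalizeAt K b h = 1 := by
  unfold normalizeAt
  rw [Finset.sum_add_distrib, Finset.sum_ite_eq', if_pos hK, Finset.sum_ite_mem, Finset.inter_self,
    ← Finset.sum_div]
  ring

theorem sum_abs_sub_normalizeAt_le {K : Finset Γ} (hK : 1 ∈ K) {a b : Γ → ℝ}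
    (ha : ∑ h ∈ K, a h ≤ 1) (hb : ∀ h, 0 ≤ b h) :
    ∑ h ∈ K, |a h - normalizeAt K b h| ≤ 3 * ∑ h ∈ K, |a h - b h| + (1 - ∑ h ∈ K, a h) := by
  set T := ∑ k ∈ K, b k with hT
  set M := max 1 T with hM
  have hM1 : 1 ≤ M := le_max_left _ _
  have hM0 : 0 < M := by linarith
  have hpt : ∀ h ∈ K, |a h - normalizeAt K b h| ≤
      |a h - b h| + (b h - b h / M) + if h = 1 then 1 - T / M else 0 := by
    intro h hh
    have h1 : 0 ≤ b h - b h / M := sub_nonneg.2 (div_le_self (hb h) hM1)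
    have h2 : 0 ≤ if h = 1 then 1 - T / M else 0 := by
      split_ifs
      exacts [sub_nonneg.2 (div_max_one_le_one T), le_rfl]
    have h3 : a h - normalizeAt K b h =
        (a h - b h) + (b h - b h / M) - if h = 1 then 1 - T / M else 0 := by
      simp only [normalizeAt, hh, if_true]
      ring
    rw [h3]
    refine (abs_sub _ _).trans (add_le_add ((abs_add_le _ _).trans ?_) (abs_of_nonneg h2).le)
    rw [abs_of_nonneg h1]
  have hd : |∑ h ∈ K, a h - T| ≤ ∑ h ∈ K, |a h - b h| := by
    rw [hT, ← Finset.sum_sub_distrib]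
    exact Finset.abs_sum_le_sum_abs _ _
  have hd' := abs_le.1 hd
  have h1 : (T - T / M) + (1 - T / M) ≤
      2 * ∑ h ∈ K, |a h - b h| + (1 - ∑ h ∈ K, a h) := by
    have := abs_nonneg (∑ h ∈ K, a h - T)
    rcases le_total T 1 with h | h
    · rw [hM, max_eq_left h]
      linarith [hd'.1, hd'.2]
    · rw [hM, max_eq_right h, div_self (by linarith)]
      linarith [hd'.1, hd'.2]
  calc _ ≤ ∑ h ∈ K, (|a h - b h| + (b h - b h / M) + if h = 1 then 1 - T / M else 0) :=
        Finset.sum_le_sum hpt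
    _ = ∑ h ∈ K, |a h - b h| + ((T - T / M) + (1 - T / M)) := by
        rw [Finset.sum_add_distrib, Finset.sum_add_distrib, Finset.sum_ite_eq', if_pos hK,
          Finset.sum_sub_distrib, ← Finset.sum_div]
        ring
    _ ≤ _ := by linarith

theorem IsProbField.tsum_abs_sub_eq {α : Type*} {v u : EqRelSpace α → α → ℝ} (hv : IsProbField v)
    {K : Finset α} (huK : ∀ r g, g ∉ K → u r g = 0) (r : EqRelSpace α) :
    ∑' h, |v r h - u r h| = ∑ h ∈ K, |v r h - u r h| + (1 - ∑ h ∈ K, v r h) := by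
  have h1 : HasSum (fun h => |v r h - u r h| - v r h) (∑ h ∈ K, (|v r h - u r h| - v r h)) :=
    hasSum_sum_of_ne_finset_zero fun h hh => by
      rw [huK r h hh, sub_zero, abs_of_nonneg (hv.nonneg r h), sub_self]
  have h2 := h1.add (hv.summable r).hasSum
  simp only [sub_add_cancel, hv.tsum_eq_one, Finset.sum_sub_distrib] at h2
  rw [h2.tsum_eq]
  ring

theorem IsProbField.sum_le_one {α : Type*} {v : EqRelSpace α → α → ℝ} (hv : IsProbField v)
    (K : Finset α) (r : EqRelSpace α) : ∑ h ∈ K, v r h ≤ 1 :=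
  (hv.tsum_eq_one r).symm ▸ (hv.summable r).sum_le_tsum K fun h _ => hv.nonneg r h

theorem IsProbField.integrable {α : Type*} {v : EqRelSpace α → α → ℝ} (hv : IsProbField v)
    (ρ : Measure (EqRelSpace α)) [IsFiniteMeasure ρ] (h : α) : Integrable (fun r => v r h) ρ := by
  refine Integrable.of_bound (hv.measurable h).aestronglyMeasurable 1
    (Filter.Eventually.of_forall fun r => ?_)
  rw [Real.norm_eq_abs, abs_of_nonneg (hv.nonneg r h)]
  simpa using hv.sum_le_one {h} r

theorem IsProbField.exists_integral_tail_lt {α : Type*} [Countable α]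
    {v : EqRelSpace α → α → ℝ} (hv : IsProbField v) (ρ : Measure (EqRelSpace α))
    [IsFiniteMeasure ρ] {δ : ℝ} (hδ : 0 < δ) (a : α) :
    ∃ K : Finset α, a ∈ K ∧ ∫ r, (1 - ∑ h ∈ K, v r h) ∂ρ < δ := by
  have h : Tendsto (fun K : Finset α => ∫ r, (1 - ∑ h ∈ K, v r h) ∂ρ) atTop
      (𝓝 (∫ _, (0 : ℝ) ∂ρ)) := by
    refine tendsto_integral_filter_of_dominated_convergence (fun _ => 1)
      (Filter.Eventually.of_forall fun K => ?_)
      (Filter.Eventually.of_forall fun K => Filter.Eventually.of_forall fun r => ?_)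
      (integrable_const _) (Filter.Eventually.of_forall fun r => ?_)
    · exact (measurable_const.sub (Finset.measurable_fun_sum _ fun h _ =>
        hv.measurable h)).aestronglyMeasurable
    · have h1 := hv.sum_le_one K r
      have h2 : 0 ≤ ∑ h ∈ K, v r h := Finset.sum_nonneg fun h _ => hv.nonneg r h
      rw [Real.norm_eq_abs, abs_le]
      constructor <;> linarith
    · have := (hv.summable r).hasSum.const_sub 1
      rwa [hv.tsum_eq_one, sub_self] at this
  rw [integral_zero] at h
  obtain ⟨K, hK⟩ := ((h.eventually (gt_mem_nhds hδ)).and (eventually_ge_atTop {a})).exists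
  exact ⟨K, hK.2 (Finset.mem_singleton_self a), hK.1⟩

theorem IsProbField.exists_continuous_approx [Countable Γ] {v : EqRelSpace Γ → Γ → ℝ}
    (hv : IsProbField v) (ρ : Measure (EqRelSpace Γ)) [IsFiniteMeasure ρ] {δ : ℝ} (hδ : 0 < δ) :
    ∃ (K : Finset Γ) (u : EqRelSpace Γ → Γ → ℝ), IsProbField u ∧
      (∀ h, Continuous fun r => u r h) ∧ (∀ r g, g ∉ K → u r g = 0) ∧
      ∫ r, ∑' h, |v r h - u r h| ∂ρ < δ := by
  obtain ⟨K, hK, hKδ⟩ := hv.exists_integral_tail_lt ρ (δ := δ / 4) (by linarith) 1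
  have hη : 0 < δ / (8 * K.card + 1) := by positivity
  choose w hw hwint using fun h : Γ =>
    (hv.integrable ρ h).exists_boundedContinuous_integral_sub_le hη
  set b : EqRelSpace Γ → Γ → ℝ := fun r h => max (w h r) 0 with hb
  have hb0 : ∀ r h, 0 ≤ b r h := fun r h => le_max_right _ _
  have hbc : ∀ h, Continuous fun r => b r h := fun h => (w h).continuous.max continuous_const
  have hvb : ∀ r h, |v r h - b r h| ≤ ‖v r h - w h r‖ := fun r h => by
    have := abs_max_sub_max_le_abs (v r h) (w h r) 0
    rwa [max_eq_left (hv.nonneg r h)] at this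
  set u : EqRelSpace Γ → Γ → ℝ := fun r => normalizeAt K (b r) with hu
  have huc : ∀ h, Continuous fun r => u r h := by
    intro h
    have hT : Continuous fun r => ∑ k ∈ K, b r k := continuous_finsetSum _ fun k _ => hbc k
    have hM : Continuous fun r => max 1 (∑ k ∈ K, b r k) := continuous_const.max hT
    have hM0 : ∀ r, max 1 (∑ k ∈ K, b r k) ≠ 0 := fun r =>
      (zero_lt_one.trans_le (le_max_left _ _)).ne'
    refine Continuous.add ?_ ?_
    · by_cases hh : h ∈ K
      · simp only [hh, if_true]
        exact (hbc h).div hM hM0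
      · simpa only [hh, if_false] using continuous_const
    · by_cases hh : h = 1
      · simp only [hh, if_true]
        exact continuous_const.sub (hT.div hM hM0)
      · simpa only [hh, if_false] using continuous_const
  have huK : ∀ r g, g ∉ K → u r g = 0 := fun r g hg => normalizeAt_eq_zero hK hg
  have hup : IsProbField u := by
    refine ⟨fun g => (huc g).measurable, fun r g => normalizeAt_nonneg (hb0 r) g, fun r => ?_⟩
    rw [tsum_eq_sum fun g hg => huK r g hg]
    exact sum_normalizeAt hK _
  refine ⟨K, u, hup, huc, huK, ?_⟩
  have hint1 : ∀ h, Integrable (fun r => ‖v r h - w h r‖) ρ := fun h =>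
    ((hv.integrable ρ h).sub (hwint h)).norm
  have hint2 : Integrable (fun r => ∑ h ∈ K, ‖v r h - w h r‖) ρ :=
    integrable_finsetSum _ fun h _ => hint1 h
  have hint3 : Integrable (fun r => 1 - ∑ h ∈ K, v r h) ρ :=
    (integrable_const _).sub (integrable_finsetSum _ fun h _ => hv.integrable ρ h)
  have hint4 : Integrable (fun r => ∑' h, |v r h - u r h|) ρ := by
    simp only [hv.tsum_abs_sub_eq huK]
    exact (integrable_finsetSum _ fun h _ =>
      ((hv.integrable ρ h).sub (hup.integrable ρ h)).abs).add hint3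
  calc ∫ r, ∑' h, |v r h - u r h| ∂ρ
      ≤ ∫ r, (3 * ∑ h ∈ K, ‖v r h - w h r‖ + 2 * (1 - ∑ h ∈ K, v r h)) ∂ρ := by
        refine integral_mono hint4 ((hint2.const_mul 3).add (hint3.const_mul 2)) fun r => ?_
        simp only [hv.tsum_abs_sub_eq huK]
        have h1 := sum_abs_sub_normalizeAt_le hK (hv.sum_le_one K r) (hb0 r)
        have h2 : ∑ h ∈ K, |v r h - b r h| ≤ ∑ h ∈ K, ‖v r h - w h r‖ :=
          Finset.sum_le_sum fun h _ => hvb r h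
        simp only [hu]
        linarith
    _ = 3 * ∑ h ∈ K, ∫ r, ‖v r h - w h r‖ ∂ρ + 2 * ∫ r, (1 - ∑ h ∈ K, v r h) ∂ρ := by
        rw [integral_add (hint2.const_mul 3) (hint3.const_mul 2), integral_const_mul,
          integral_const_mul, integral_finsetSum _ fun h _ => hint1 h]
    _ < δ := by
        have h1 : ∑ h ∈ K, ∫ r, ‖v r h - w h r‖ ∂ρ ≤ K.card * (δ / (8 * K.card + 1)) := by
          rw [← nsmul_eq_mul]
          exact Finset.sum_le_card_nsmul _ _ _ fun h _ => hw h
        have h2 : K.card * (δ / (8 * K.card + 1)) ≤ δ / 8 := by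
          rw [← mul_div_assoc, div_le_div_iff₀ (by positivity) (by norm_num)]
          nlinarith
        linarith

theorem continuous_equivDefect {S K : Finset Γ} {u : EqRelSpace Γ → Γ → ℝ}
    (huc : ∀ h, Continuous fun r => u r h) (huK : ∀ r g, g ∉ K → u r g = 0) :
    Continuous (equivDefect S u) := by
  refine continuous_finsetSum _ fun s _ => ?_
  have h1 : ∀ r : EqRelSpace Γ,
      (if r.1 (1, s) = true then ∑' h, |u r (s * h) - u (shiftE s⁻¹ r) h| else 0) =
      (if r.1 (1, s) = true then (1 : ℝ) else 0) *
        ∑ h ∈ K.image (fun k => s⁻¹ * k) ∪ K, |u r (s * h) - u (shiftE s⁻¹ r) h| := by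
    intro r
    split_ifs
    · rw [one_mul]
      refine tsum_eq_sum fun h hh => ?_
      rw [Finset.mem_union, not_or] at hh
      rw [huK _ h hh.2, huK r (s * h) fun h' => hh.1 (Finset.mem_image.2 ⟨s * h, h', by simp⟩)]
      simp
    · simp
  simp only [h1]
  refine Continuous.mul ?_ (continuous_finsetSum _ fun h _ =>
    ((huc _).sub ((huc h).comp (continuous_shiftE _))).abs)
  exact (continuous_of_discreteTopology (f := fun b : Bool => if b = true then (1 : ℝ) else 0)).comp
    ((continuous_apply (1, s)).comp continuous_subtype_val)

theorem integrable_equivDefect [Countable Γ] (S : Finset Γ) {u : EqRelSpace Γ → Γ → ℝ}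
    (hu : IsProbField u) (ρ : Measure (EqRelSpace Γ)) [IsFiniteMeasure ρ] :
    Integrable (equivDefect S u) ρ := by
  refine Integrable.of_bound (measurable_equivDefect S hu).aestronglyMeasurable (2 * S.card)
    (Filter.Eventually.of_forall fun r => ?_)
  rw [Real.norm_eq_abs, abs_of_nonneg (equivDefect_nonneg _ _ _)]
  exact equivDefect_le S hu r

theorem equivDefect_le_add (S : Finset Γ) {u v : EqRelSpace Γ → Γ → ℝ} (hu : IsProbField u)
    (hv : IsProbField v) (r : EqRelSpace Γ) :
    equivDefect S u r ≤ equivDefect S v r +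
      ∑ s ∈ S, (∑' h, |v r h - u r h| + ∑' h, |v (shiftE s⁻¹ r) h - u (shiftE s⁻¹ r) h|) := by
  unfold equivDefect
  rw [← Finset.sum_add_distrib]
  refine Finset.sum_le_sum fun s _ => ?_
  have hN : ∀ r, Summable fun h => |v r h - u r h| := fun r =>
    ((hv.summable r).sub (hu.summable r)).abs
  have hN' : Summable fun h => |v r (s * h) - u r (s * h)| :=
    ((hv.summable_mul_left r s).sub (hu.summable_mul_left r s)).abs
  split_ifs
  · have hshift : ∑' h, |v r (s * h) - u r (s * h)| = ∑' h, |v r h - u r h| :=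
      (Equiv.mulLeft s).tsum_eq fun h => |v r h - u r h|
    rw [← hshift, ← hN'.tsum_add (hN _), ← (hv.summable_abs_sub _ _ _).tsum_add (hN'.add (hN _))]
    refine (hu.summable_abs_sub _ _ _).tsum_le_tsum (fun h => ?_)
      ((hv.summable_abs_sub _ _ _).add (hN'.add (hN _)))
    have h1 : u r (s * h) - u (shiftE s⁻¹ r) h = (v r (s * h) - v (shiftE s⁻¹ r) h) -
        (v r (s * h) - u r (s * h)) + (v (shiftE s⁻¹ r) h - u (shiftE s⁻¹ r) h) := by ring
    rw [h1]
    refine (abs_add_le _ _).trans ?_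
    linarith [abs_sub (v r (s * h) - v (shiftE s⁻¹ r) h) (v r (s * h) - u r (s * h))]
  · rw [zero_add]
    exact add_nonneg (tsum_nonneg fun _ => abs_nonneg _) (tsum_nonneg fun _ => abs_nonneg _)

theorem integral_equivDefect_le_add [Countable Γ] (S : Finset Γ) {u v : EqRelSpace Γ → Γ → ℝ}
    (hu : IsProbField u) (hv : IsProbField v) {ρ : ProbabilityMeasure (EqRelSpace Γ)}
    (hρ : IsIRE ρ) :
    ∫ r, equivDefect S u r ∂ρ.toMeasure ≤ ∫ r, equivDefect S v r ∂ρ.toMeasure +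
      2 * S.card * ∫ r, ∑' h, |v r h - u r h| ∂ρ.toMeasure := by
  set N : EqRelSpace Γ → ℝ := fun r => ∑' h, |v r h - u r h| with hN
  have hNm : Measurable N := Measurable.tsum_abs fun h => (hv.measurable h).sub (hu.measurable h)
  have hN2 : ∀ r, ‖N r‖ ≤ 2 := by
    intro r
    rw [Real.norm_eq_abs, abs_of_nonneg (tsum_nonneg fun _ => abs_nonneg _)]
    calc N r ≤ ∑' h, (v r h + u r h) := by
          refine Summable.tsum_le_tsum (fun h => ?_) ((hv.summable r).sub (hu.summable r)).abs
            ((hv.summable r).add (hu.summable r))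
          rw [abs_le]
          constructor <;> linarith [hv.nonneg r h, hu.nonneg r h]
      _ = 2 := by
          rw [(hv.summable r).tsum_add (hu.summable r), hv.tsum_eq_one, hu.tsum_eq_one]
          norm_num
  have hNi : Integrable N ρ.toMeasure :=
    Integrable.of_bound hNm.aestronglyMeasurable 2 (Filter.Eventually.of_forall hN2)
  have hNi' : ∀ s : Γ, Integrable (fun r => N (shiftE s r)) ρ.toMeasure := fun s =>
    Integrable.of_bound (hNm.comp (measurable_shiftE s)).aestronglyMeasurable 2
      (Filter.Eventually.of_forall fun r => hN2 _)
  have hNs : ∀ s : Γ, ∫ r, N (shiftE s r) ∂ρ.toMeasure = ∫ r, N r ∂ρ.toMeasure := by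
    intro s
    conv_rhs => rw [← hρ s]
    exact (integral_map (measurable_shiftE s).aemeasurable hNm.aestronglyMeasurable).symm
  have hNadd : ∀ s : Γ, Integrable (fun r => N r + N (shiftE s r)) ρ.toMeasure := fun s =>
    hNi.add (hNi' s)
  calc ∫ r, equivDefect S u r ∂ρ.toMeasure
      ≤ ∫ r, (equivDefect S v r + ∑ s ∈ S, (N r + N (shiftE s⁻¹ r))) ∂ρ.toMeasure :=
        integral_mono (integrable_equivDefect S hu _) ((integrable_equivDefect S hv _).add
          (integrable_finsetSum _ fun s _ => hNadd _)) (equivDefect_le_add S hu hv)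
    _ = _ := by
        rw [integral_add (integrable_equivDefect S hv _)
          (integrable_finsetSum _ fun s _ => hNadd _),
          integral_finsetSum _ fun s _ => hNadd _]
        simp only [integral_add hNi (hNi' _), hNs, Finset.sum_const, nsmul_eq_mul]
        ring

theorem IsAIRE.exists_integral_equivDefect_lt [Countable Γ]
    {ρ : ProbabilityMeasure (EqRelSpace Γ)} (hρ : IsAIRE ρ) (S : Finset Γ) {δ : ℝ} (hδ : 0 < δ) :
    ∃ v, IsProbField v ∧ ∫ r, equivDefect S v r ∂ρ.toMeasure < δ := by
  obtain ⟨-, lam, hm, h0, h1, hlim⟩ := hρ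
  have hlam : ∀ n, IsProbField (lam n) := fun n => ⟨hm n, h0 n, h1 n⟩
  have h : Tendsto (fun n => ∫ r, equivDefect S (lam n) r ∂ρ.toMeasure) atTop
      (𝓝 (∫ _, (0 : ℝ) ∂ρ.toMeasure)) := by
    refine tendsto_integral_of_dominated_convergence (fun _ => 2 * S.card)
      (fun n => (measurable_equivDefect S (hlam n)).aestronglyMeasurable) (integrable_const _)
      (fun n => Filter.Eventually.of_forall fun r => ?_) ?_
    · rw [Real.norm_eq_abs, abs_of_nonneg (equivDefect_nonneg _ _ _)]
      exact equivDefect_le S (hlam n) r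
    · filter_upwards [hlim] with r hr
      rw [← Finset.sum_const_zero (s := S)]
      refine tendsto_finsetSum _ fun s _ => ?_
      split_ifs with hs
      exacts [hr s hs, tendsto_const_nhds]
  rw [integral_zero] at h
  obtain ⟨n, hn⟩ := (h.eventually (gt_mem_nhds hδ)).exists
  exact ⟨lam n, hlam n, hn⟩

theorem IsIRE.of_tendsto [Countable Γ] {ρs : ℕ → ProbabilityMeasure (EqRelSpace Γ)}
    {ρ : ProbabilityMeasure (EqRelSpace Γ)} (hρs : ∀ n, IsIRE (ρs n))
    (h : Tendsto ρs atTop (𝓝 ρ)) : IsIRE ρ := by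
  intro γ
  have h1 := ((ProbabilityMeasure.continuous_map (continuous_shiftE γ)).tendsto ρ).comp h
  have h2 : (fun ν : ProbabilityMeasure (EqRelSpace Γ) =>
      ν.map (continuous_shiftE γ).measurable.aemeasurable) ∘ ρs = ρs :=
    funext fun n => Subtype.ext (hρs n γ)
  rw [h2] at h1
  exact congrArg ProbabilityMeasure.toMeasure (tendsto_nhds_unique h1 h)

theorem isClosed_isEqRel (α : Type*) : IsClosed {r : α × α → Bool | IsEqRel r} := by
  have h : ∀ q : α × α, IsClopen {r : α × α → Bool | r q = true} := fun q =>
    (isClopen_discrete {true}).preimage (continuous_apply q)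
  have himp : ∀ {p q : (α × α → Bool) → Prop}, IsClopen {r | p r} → IsClopen {r | q r} →
      IsClopen {r | p r → q r} := fun {p q} hp hq => by
    simp only [imp_iff_not_or]
    exact hp.compl.union hq
  have h1 : {r : α × α → Bool | IsEqRel r} = (⋂ x, {r | r (x, x) = true}) ∩
      ((⋂ x, ⋂ y, {r | r (x, y) = true → r (y, x) = true}) ∩
      ⋂ x, ⋂ y, ⋂ z, {r | r (x, y) = true → r (y, z) = true → r (x, z) = true}) := by
    ext r
    simp [IsEqRel]
  rw [h1]
  refine (isClosed_iInter fun x => (h _).isClosed).inter (IsClosed.inter ?_ ?_)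
  · exact isClosed_iInter fun x => isClosed_iInter fun y => (himp (h _) (h _)).isClosed
  · exact isClosed_iInter fun x => isClosed_iInter fun y => isClosed_iInter fun z =>
      (himp (h _) (himp (h _) (h _))).isClosed

instance (α : Type*) : CompactSpace (EqRelSpace α) :=
  isCompact_iff_compactSpace.1 (isClosed_isEqRel α).isCompact

theorem not_isAIRE_of_tendsto [Countable Γ] {S : Finset Γ} {κ : ℝ} (hκ : 0 < κ)
    {ρs : ℕ → ProbabilityMeasure (EqRelSpace Γ)} {ρ : ProbabilityMeasure (EqRelSpace Γ)}
    (h : Tendsto ρs atTop (𝓝 ρ))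
    (hρs : ∀ (K : Finset Γ), ∀ᶠ n in atTop, ∀ u, IsProbField u → (∀ r g, g ∉ K → u r g = 0) →
      κ ≤ ∫ r, equivDefect S u r ∂(ρs n).toMeasure) : ¬ IsAIRE ρ := by
  intro hρ
  obtain ⟨v, hv, hvδ⟩ := hρ.exists_integral_equivDefect_lt S (δ := κ / 2) (by linarith)
  obtain ⟨K, u, hu, huc, huK, huδ⟩ := hv.exists_continuous_approx ρ.toMeasure
    (δ := κ / (4 * S.card + 1)) (by positivity)
  have h1 := integral_equivDefect_le_add S hu hv hρ.1
  have h2 := (ProbabilityMeasure.tendsto_iff_forall_integral_tendsto.1 h)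
    (BoundedContinuousFunction.mkOfCompact ⟨equivDefect S u, continuous_equivDefect huc huK⟩)
  have h3 : κ ≤ ∫ r, equivDefect S u r ∂ρ.toMeasure :=
    ge_of_tendsto h2 ((hρs K).mono fun n hn => hn u hu huK)
  have h4 : 2 * S.card * (κ / (4 * S.card + 1)) ≤ κ / 2 := by
    rw [← mul_div_assoc, div_le_div_iff₀ (by positivity) (by norm_num)]
    nlinarith
  have h5 := mul_le_mul_of_nonneg_left huδ.le (by positivity : (0 : ℝ) ≤ 2 * S.card)
  linarith

theorem exists_expanding_of_not_isExactGroup [Countable Γ] (h : ¬ IsExactGroup Γ) :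
    ∃ (S : Finset Γ) (ε : ℝ), 0 < ε ∧ ∀ K : Finset Γ, ∃ F : Finset Γ, F.Nonempty ∧
      ∀ E ⊆ F, E.Nonempty → (∃ g, ∀ x ∈ E, x⁻¹ * g ∈ K) →
        ε * E.card ≤ (outerBoundary S F E).card := by
  by_contra! hc
  refine h (isExactGroup_of_locallyAmenable fun S _ ε hε => ?_)
  obtain ⟨K, hK⟩ := hc S ε hε
  refine ⟨K.image (·⁻¹), fun F hF => ?_⟩
  obtain ⟨E, hEF, hE, ⟨g, hg⟩, hlt⟩ := hK F hF
  refine ⟨E, hEF, hE, ⟨g, fun x hx => ?_⟩, hlt.le⟩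
  exact Finset.mem_image.2 ⟨x⁻¹ * g, hg x hx, by simp⟩

theorem exists_unitInterval_mul_eq {c : ℝ} (hc0 : 0 ≤ c) (hc1 : c ≤ 1) {n : ℕ} (hn : 0 < n) :
    ∃ p : unitInterval, (n : ℝ) * p = c := by
  have h1 : (1 : ℝ) ≤ n := by exact_mod_cast hn
  refine ⟨⟨c / n, by positivity, div_le_one_of_le₀ (hc1.trans h1) (by positivity)⟩, ?_⟩
  exact mul_div_cancel₀ c (by positivity)

theorem exists_isFIRE_equivDefect_ge [Countable Γ] (h : ¬ IsExactGroup Γ) :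
    ∃ (S : Finset Γ) (κ : ℝ), 0 < κ ∧ ∀ K : Finset Γ, ∃ ρ : ProbabilityMeasure (EqRelSpace Γ),
      IsFIRE ρ ∧ ∀ u, IsProbField u → (∀ r g, g ∉ K → u r g = 0) →
        κ ≤ ∫ r, equivDefect S u r ∂ρ.toMeasure := by
  obtain ⟨S, ε, hε, hS⟩ := exists_expanding_of_not_isExactGroup h
  set c : ℝ := ε / (2 * (ε + 2 * S.card)) with hc
  have hc0 : 0 < c := by positivity
  have hc1 : c ≤ 1 := div_le_one_of_le₀ (by linarith [(Nat.cast_nonneg S.card : (0 : ℝ) ≤ _)])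
    (by positivity)
  refine ⟨S, ε * c / 2, by positivity, fun K => ?_⟩
  obtain ⟨F, hF0, hF⟩ := hS K
  obtain ⟨p, hp⟩ := exists_unitInterval_mul_eq hc0.le hc1 hF0.card_pos
  refine ⟨tileLaw F p, isFIRE_tileLaw F p, fun u hu huK => ?_⟩
  refine le_trans (le_of_eq ?_) (integral_equivDefect_tileLaw_ge hε.le hF hu huK p)
  rw [mul_assoc, hp]
  have : (ε + 2 * S.card) * c = ε / 2 := by
    rw [hc]
    field_simp
  linear_combination c * this

end RandomTilings

theorem nonexact_exists_weakLimit_of_FIREs_not_AIRE {Γ : Type*} [Group Γ] [Countable Γ]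
    (hnonexact : ¬ IsExactGroup Γ) :
    ∃ (ρs : ℕ → ProbabilityMeasure (EqRelSpace Γ)) (ρ : ProbabilityMeasure (EqRelSpace Γ)),
      (∀ n, IsFIRE (ρs n)) ∧ IsIRE ρ ∧ Tendsto ρs atTop (𝓝 ρ) ∧ ¬ IsAIRE ρ := by
  obtain ⟨S, κ, hκ, h⟩ := exists_isFIRE_equivDefect_ge hnonexact
  obtain ⟨K, -, hK⟩ := exists_seq_monotone_tendsto_atTop_atTop (Finset Γ)
  choose ρs hfire hdefect using fun n => h (K n)
  obtain ⟨ρ, φ, hφ, hlim⟩ := CompactSpace.tendsto_subseq ρs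
  refine ⟨ρs ∘ φ, ρ, fun n => hfire _, IsIRE.of_tendsto (fun n => (hfire (φ n)).1) hlim, hlim,
    not_isAIRE_of_tendsto (S := S) hκ hlim fun A => ?_⟩
  filter_upwards [hφ.tendsto_atTop.eventually (hK.eventually_ge_atTop A)] with n hn u hu huA
  exact hdefect (φ n) u hu fun r g hg => huA r g fun hgA => hg (hn hgA)
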